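/- Let f : ℕ → ℕ be any function with f(n) → ∞ as n → ∞, and fix k ∈ ℕ. For the n²−1 puzzle chain started at the identity, let σ be the state after n⁴·f(n) steps. Then the probability that #{p ∈ (ℤ/nℤ)² : p ≠ (n−1,n−1) and σ(p) = p} = k (i.e., exactly k numbered pieces are in their original position) converges to e^{−1}/k! as n → ∞. -/

import Mathlib

open Finset

/-- The label of the empty square: `(n−1, n−1)`. -/
def emptyLabel (n : ℕ) : ZMod n × ZMod n := (((n - 1 : ℕ) : ZMod n), ((n - 1 : ℕ) : ZMod n))

/-- The five displacements `{(0,0),(1,0),(−1,0),(0,1),(0,−1)}` of the empty square. -/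
def displacements (n : ℕ) : Finset (ZMod n × ZMod n) :=
  {((0 : ZMod n), (0 : ZMod n)), (1, 0), (-1, 0), (0, 1), (0, -1)}

open Classical in
/-- One-step transition probability of the `n²−1` puzzle chain on `Sym((ℤ/nℤ)²)`:
from the arrangement `σ` a displacement `d` is chosen uniformly among the five
possibilities and `σ` is replaced by `τ ∘ σ`, where `τ` is the transposition of the
positions `σ(b)` and `σ(b) + d` of the board (`b = (n−1,n−1)` the label of the empty
square). -/
noncomputable def puzzleStep (n : ℕ) (σ τ : Equiv.Perm (ZMod n × ZMod n)) : ℝ :=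
  (1 / 5 : ℝ) * (((displacements n).filter
    (fun d => τ = Equiv.swap (σ (emptyLabel n)) (σ (emptyLabel n) + d) * σ)).card : ℝ)

/-- The distribution of the `n²−1` puzzle chain after `N` steps, started at the identity
arrangement. -/
noncomputable def puzzleDist (n : ℕ) [NeZero n] : ℕ → Equiv.Perm (ZMod n × ZMod n) → ℝ
  | 0 => fun τ => if τ = 1 then 1 else 0
  | (N + 1) => fun τ => ∑ σ : Equiv.Perm (ZMod n × ZMod n), puzzleDist n N σ * puzzleStep n σ τ

open Classical in
/-- The number of numbered pieces (labels `p ≠ (n−1,n−1)`) in their original position in the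
arrangement `σ`. -/
noncomputable def fixedPieces (n : ℕ) [NeZero n] (σ : Equiv.Perm (ZMod n × ZMod n)) : ℕ :=
  (Finset.univ.filter (fun p : ZMod n × ZMod n => p ≠ emptyLabel n ∧ σ p = p)).card

section SquareSums

variable {X : Type*}

theorem sum_sq_comp_le {S : Finset X} (f : X → ℝ) {g₁ g₂ : X → X}
    (hmaps : ∀ x ∈ S, g₂ x ∈ S) (hinj : Function.Injective g₂) :
    ∑ x ∈ S, (f (g₁ (g₂ x)) - f x) ^ 2 ≤
      2 * ∑ x ∈ S, (f (g₁ x) - f x) ^ 2 + 2 * ∑ x ∈ S, (f (g₂ x) - f x) ^ 2 := by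
  classical
  have h1 : ∑ x ∈ S, (f (g₁ (g₂ x)) - f (g₂ x)) ^ 2 ≤ ∑ x ∈ S, (f (g₁ x) - f x) ^ 2 := by
    rw [← Finset.sum_image (f := fun y => (f (g₁ y) - f y) ^ 2) (g := g₂) hinj.injOn]
    refine Finset.sum_le_sum_of_subset_of_nonneg ?_ fun _ _ _ => sq_nonneg _
    intro y hy
    obtain ⟨x, hx, rfl⟩ := Finset.mem_image.1 hy
    exact hmaps x hx
  have h2 : ∑ x ∈ S, (f (g₁ (g₂ x)) - f x) ^ 2 ≤
      ∑ x ∈ S, (2 * (f (g₁ (g₂ x)) - f (g₂ x)) ^ 2 + 2 * (f (g₂ x) - f x) ^ 2) := by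
    refine Finset.sum_le_sum fun x _ => ?_
    nlinarith [sq_nonneg ((f (g₁ (g₂ x)) - f (g₂ x)) - (f (g₂ x) - f x))]
  rw [Finset.sum_add_distrib, ← Finset.mul_sum, ← Finset.mul_sum] at h2
  linarith

/-- Displacing along disjoint translates of `A` costs only one copy of the energy per step. -/
theorem sum_sq_iterate_le_of_injOn {A S : Finset X} (f : X → ℝ) {g : X → X} (m : ℕ)
    (hmaps : ∀ j < m, ∀ x ∈ A, g^[j] x ∈ S)
    (hinj : ∀ i < m, ∀ j < m, ∀ x ∈ A, ∀ y ∈ A, g^[i] x = g^[j] y → i = j ∧ x = y) :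
    ∑ x ∈ A, (f (g^[m] x) - f x) ^ 2 ≤ m * ∑ x ∈ S, (f (g x) - f x) ^ 2 := by
  classical
  have h1 : ∀ x ∈ A, (f (g^[m] x) - f x) ^ 2 ≤
      m * ∑ j ∈ range m, (f (g (g^[j] x)) - f (g^[j] x)) ^ 2 := by
    intro x _
    have h := Finset.sum_range_sub (fun j => f (g^[j] x)) m
    simp only [Function.iterate_succ_apply', Function.iterate_zero, id] at h
    rw [← h]
    simpa using sq_sum_le_card_mul_sum_sq (s := range m)
      (f := fun j => f (g (g^[j] x)) - f (g^[j] x))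
  refine (Finset.sum_le_sum h1).trans ?_
  rw [← Finset.mul_sum]
  refine mul_le_mul_of_nonneg_left ?_ (Nat.cast_nonneg m)
  rw [← Finset.sum_product' (f := fun x j => (f (g (g^[j] x)) - f (g^[j] x)) ^ 2)]
  have hi : Set.InjOn (fun q : X × ℕ => g^[q.2] q.1) ↑(A ×ˢ range m) := by
    rintro ⟨x, i⟩ hx ⟨y, j⟩ hy h
    simp only [coe_product, Set.mem_prod, mem_coe, Finset.mem_range] at hx hy
    obtain ⟨rfl, rfl⟩ := hinj i hx.2 j hy.2 x hx.1 y hy.1 h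
    rfl
  rw [← Finset.sum_image (f := fun y => (f (g y) - f y) ^ 2) hi]
  refine Finset.sum_le_sum_of_subset_of_nonneg ?_ fun _ _ _ => sq_nonneg _
  intro y hy
  obtain ⟨⟨x, j⟩, hx, rfl⟩ := Finset.mem_image.1 hy
  simp only [mem_product, Finset.mem_range] at hx
  exact hmaps j hx.2 x hx.1

theorem sum_sq_iterate_le {S : Finset X} (f : X → ℝ) {g : X → X} (m : ℕ)
    (hmaps : ∀ x ∈ S, g x ∈ S) (hinj : Function.Injective g) :
    ∑ x ∈ S, (f (g^[m] x) - f x) ^ 2 ≤ m ^ 2 * ∑ x ∈ S, (f (g x) - f x) ^ 2 := by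
  classical
  have hit : ∀ j, ∀ x ∈ S, g^[j] x ∈ S := fun j => by
    induction j with
    | zero => simp
    | succ j ih => intro x hx; rw [Function.iterate_succ_apply']; exact hmaps _ (ih x hx)
  have h1 : ∀ x ∈ S, (f (g^[m] x) - f x) ^ 2 ≤
      m * ∑ j ∈ range m, (f (g (g^[j] x)) - f (g^[j] x)) ^ 2 := by
    intro x _
    have h := Finset.sum_range_sub (fun j => f (g^[j] x)) m
    simp only [Function.iterate_succ_apply', Function.iterate_zero, id] at h
    rw [← h]
    simpa using sq_sum_le_card_mul_sum_sq (s := range m)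
      (f := fun j => f (g (g^[j] x)) - f (g^[j] x))
  refine (Finset.sum_le_sum h1).trans ?_
  rw [← Finset.mul_sum, sq, mul_assoc]
  refine mul_le_mul_of_nonneg_left ?_ (Nat.cast_nonneg m)
  rw [Finset.sum_comm]
  calc _ ≤ ∑ j ∈ range m, ∑ x ∈ S, (f (g x) - f x) ^ 2 := by
        refine Finset.sum_le_sum fun j _ => ?_
        rw [← Finset.sum_image (f := fun y => (f (g y) - f y) ^ 2) (g := g^[j])
          (hinj.iterate j).injOn]
        refine Finset.sum_le_sum_of_subset_of_nonneg ?_ fun _ _ _ => sq_nonneg _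
        intro y hy
        obtain ⟨x, hx, rfl⟩ := Finset.mem_image.1 hy
        exact hit j x hx
    _ = _ := by simp

end SquareSums

/-- The board `(ℤ/nℤ)²`. -/
abbrev Board (n : ℕ) := ZMod n × ZMod n

/-- Slide the empty square, carried by the label `b`, by the displacement `d` in the arrangement
`x` of labels on the board. -/
def slide {n : ℕ} {L : Type*} (b : L) (d : Board n) (x : L → Board n) : L → Board n :=
  fun l => Equiv.swap (x b) (x b + d) (x l)

section Slide

variable {n : ℕ} {L M : Type*} (b : L) (d : Board n) (x : L → Board n)

@[simp] theorem slide_hole : slide b d x b = x b + d := by simp [slide]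

theorem slide_comp (c : M) (y : M → L) : slide c d (x ∘ y) = slide (y c) d x ∘ y := rfl

theorem slide_neg_slide : slide b (-d) (slide b d x) = x := by
  funext l
  simp only [slide, Equiv.swap_apply_left, add_neg_cancel_right]
  rw [Equiv.swap_comm, Equiv.swap_apply_self]

theorem slide_injective : Function.Injective (slide b d : (L → Board n) → L → Board n) :=
  Function.LeftInverse.injective (g := slide b (-d)) (slide_neg_slide b d)

variable {x} in
theorem Function.Injective.slide (hx : Function.Injective x) :
    Function.Injective (slide b d x) :=
  (Equiv.injective _).comp hx

variable {b d x} in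
theorem slide_of_ne {l : L} (h₁ : x l ≠ x b) (h₂ : x l ≠ x b + d) : slide b d x l = x l :=
  Equiv.swap_apply_of_ne_of_ne h₁ h₂

theorem slide_iterate_hole (j : ℕ) : (slide b d)^[j] x b = x b + j • d := by
  induction j with
  | zero => simp
  | succ j ih => rw [Function.iterate_succ_apply', slide_hole, ih, succ_nsmul, add_assoc]

variable {b d x} in
theorem slide_iterate_of_ne {l : L} (j : ℕ) (h : ∀ i ≤ j, x l ≠ x b + i • d) :
    (slide b d)^[j] x l = x l := by
  induction j with
  | zero => simp
  | succ j ih =>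
    rw [Function.iterate_succ_apply']
    have h' := ih fun i hi => h i (hi.trans (Nat.le_succ j))
    rw [slide_of_ne, h'] <;> rw [h', slide_iterate_hole]
    · exact h j (Nat.le_succ j)
    · rw [add_assoc, ← succ_nsmul]; exact h (j + 1) le_rfl

theorem slide_iterate_comp (c : M) (y : M → L) (j : ℕ) :
    (slide c d)^[j] (x ∘ y) = (slide (y c) d)^[j] x ∘ y := by
  induction j generalizing x with
  | zero => rfl
  | succ j ih => rw [Function.iterate_succ_apply, slide_comp, ih, Function.iterate_succ_apply]

end Slide

section Energy

variable {n : ℕ} [NeZero n] {ι : Type} [Fintype ι] [DecidableEq ι]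

open Classical in
/-- Arrangements of the empty square `none` and of the labelled pieces at distinct positions. -/
noncomputable def placements (n : ℕ) [NeZero n] (ι : Type) [Fintype ι] [DecidableEq ι] :
    Finset (Option ι → Board n) :=
  Finset.univ.filter fun x => Function.Injective x

@[simp] theorem mem_placements {x : Option ι → Board n} :
    x ∈ placements n ι ↔ Function.Injective x := by
  simp [placements]

/-- The Dirichlet form of the puzzle chain, without normalization. -/
noncomputable def energy (f : (Option ι → Board n) → ℝ) : ℝ :=
  ∑ x ∈ placements n ι, ∑ d ∈ displacements n, (f (slide none d x) - f x) ^ 2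

theorem energy_nonneg (f : (Option ι → Board n) → ℝ) : 0 ≤ energy f :=
  Finset.sum_nonneg fun _ _ => Finset.sum_nonneg fun _ _ => sq_nonneg _

theorem sum_sq_slide_le (f : (Option ι → Board n) → ℝ) {d : Board n} (hd : d ∈ displacements n) :
    ∑ x ∈ placements n ι, (f (slide none d x) - f x) ^ 2 ≤ energy f := by
  refine Finset.sum_le_sum fun x _ => ?_
  exact Finset.single_le_sum (f := fun d => (f (slide none d x) - f x) ^ 2)
    (fun _ _ => sq_nonneg _) hd

theorem slide_mem_placements {d : Board n} {x : Option ι → Board n} (hx : x ∈ placements n ι) :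
    slide none d x ∈ placements n ι := by
  rw [mem_placements] at hx ⊢
  exact hx.slide _ _

theorem slide_iterate_mem_placements {d : Board n} (j : ℕ) {x : Option ι → Board n}
    (hx : x ∈ placements n ι) : (slide none d)^[j] x ∈ placements n ι := by
  induction j with
  | zero => exact hx
  | succ j ih => rw [Function.iterate_succ_apply']; exact slide_mem_placements ih

/-- Moving the hole along a straight line, for arrangements with pairwise different values of a
key that is translated at each step. -/
theorem sum_sq_line_le (f : (Option ι → Board n) → ℝ) {d : Board n} (hd : d ∈ displacements n)
    {A : Finset (Option ι → Board n)} (hA : A ⊆ placements n ι) (m : ℕ) (z : Board n)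
    (key : (Option ι → Board n) → Board n)
    (hkey : ∀ j < m, ∀ x ∈ A, key ((slide none d)^[j] x) = z + j • d)
    (hdist : ∀ i < m, ∀ j < m, i • d = j • d → i = j) :
    ∑ x ∈ A, (f ((slide none d)^[m] x) - f x) ^ 2 ≤ m * energy f := by
  refine (sum_sq_iterate_le_of_injOn (S := placements n ι) f m
    (fun j _ x hx => slide_iterate_mem_placements j (hA hx)) ?_).trans
    (mul_le_mul_of_nonneg_left (sum_sq_slide_le f hd) (Nat.cast_nonneg m))
  intro i hi j hj x hx y hy h
  have h1 := hkey i hi x hx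
  rw [h, hkey j hj y hy] at h1
  have hij := hdist i hi j hj (add_left_cancel h1.symm)
  subst hij
  exact ⟨rfl, (slide_injective none d).iterate i h⟩

end Energy

section Carry

variable {n : ℕ} {L M : Type*}

/-- The hole, to the right of a piece, moves around that piece so as to carry it one square to the
right. -/
def carry (b : L) (x : L → Board n) : L → Board n :=
  slide b (0, -1) (slide b (1, 0) (slide b (1, 0) (slide b (0, 1) (slide b (-1, 0) x))))

/-- The hole runs around a unit square, rotating the three other squares. -/
def rotate (b : L) (x : L → Board n) : L → Board n :=
  slide b (0, -1) (slide b (1, 0) (slide b (0, 1) (slide b (-1, 0) x)))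

theorem carry_comp (c : M) (x : L → Board n) (y : M → L) :
    carry c (x ∘ y) = carry (y c) x ∘ y := rfl

theorem carry_iterate_comp (c : M) (x : L → Board n) (y : M → L) (j : ℕ) :
    (carry c)^[j] (x ∘ y) = (carry (y c))^[j] x ∘ y := by
  induction j generalizing x with
  | zero => rfl
  | succ j ih => rw [Function.iterate_succ_apply, carry_comp, ih, Function.iterate_succ_apply]

theorem carry_injective (b : L) : Function.Injective (carry b : (L → Board n) → L → Board n) :=
  (slide_injective _ _).comp <| (slide_injective _ _).comp <| (slide_injective _ _).comp <|
    (slide_injective _ _).comp <| slide_injective _ _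

theorem Function.Injective.carry (b : L) {x : L → Board n} (hx : Function.Injective x) :
    Function.Injective (carry b x) :=
  ((((hx.slide _ _).slide _ _).slide _ _).slide _ _).slide _ _

theorem Function.Injective.rotate (b : L) {x : L → Board n} (hx : Function.Injective x) :
    Function.Injective (rotate b x) :=
  (((hx.slide _ _).slide _ _).slide _ _).slide _ _

theorem Function.Injective.carry_iterate (b : L) {x : L → Board n} (hx : Function.Injective x)
    (j : ℕ) : Function.Injective ((_root_.carry b)^[j] x) := by
  induction j with
  | zero => exact hx
  | succ j ih => rw [Function.iterate_succ_apply']; exact ih.carry b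

variable {b : L} {x : L → Board n} {p q : ZMod n}

theorem carry_eq (hb : x b = (p + 1, q)) (l : L) :
    carry b x l = Equiv.swap (p + 2, q + 1) (p + 2, q) (Equiv.swap (p + 1, q + 1) (p + 2, q + 1)
      (Equiv.swap (p, q + 1) (p + 1, q + 1) (Equiv.swap (p, q) (p, q + 1)
        (Equiv.swap (p + 1, q) (p, q) (x l))))) := by
  have h2 : p + 1 + 1 = p + 2 := by ring
  simp only [carry, slide, hb, Equiv.swap_apply_left, Prod.mk_add_mk, add_zero, h2,
    add_neg_cancel_right]

theorem rotate_eq (hb : x b = (p + 1, q)) (l : L) :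
    rotate b x l = Equiv.swap (p + 1, q + 1) (p + 1, q)
      (Equiv.swap (p, q + 1) (p + 1, q + 1) (Equiv.swap (p, q) (p, q + 1)
        (Equiv.swap (p + 1, q) (p, q) (x l)))) := by
  simp only [rotate, slide, hb, Equiv.swap_apply_left, Prod.mk_add_mk, add_zero,
    add_neg_cancel_right]

theorem natCast_ne_natCast {a c : ℕ} (ha : a < n) (hc : c < n) (h : a ≠ c) :
    (a : ZMod n) ≠ c := by
  intro h'
  rw [ZMod.natCast_eq_natCast_iff', Nat.mod_eq_of_lt ha, Nat.mod_eq_of_lt hc] at h'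
  exact h h'

theorem zmod_small_ne (hn : 4 ≤ n) :
    (1 : ZMod n) ≠ 0 ∧ (2 : ZMod n) ≠ 0 ∧ (2 : ZMod n) ≠ 1 ∧ (0 : ZMod n) ≠ 1 ∧
      (0 : ZMod n) ≠ 2 ∧ (1 : ZMod n) ≠ 2 := by
  have h01 := natCast_ne_natCast (n := n) (a := 0) (c := 1) (by omega) (by omega) (by omega)
  have h02 := natCast_ne_natCast (n := n) (a := 0) (c := 2) (by omega) (by omega) (by omega)
  have h12 := natCast_ne_natCast (n := n) (a := 1) (c := 2) (by omega) (by omega) (by omega)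
  push_cast at h01 h02 h12
  exact ⟨h01.symm, h02.symm, h12.symm, h01, h02, h12⟩

theorem carry_hole (hb : x b = (p + 1, q)) : carry b x b = (p + 2, q) := by
  rw [carry_eq hb]; simp [hb]

theorem carry_piece (hn : 4 ≤ n) (hb : x b = (p + 1, q)) {l : L} (hl : x l = (p, q)) :
    carry b x l = (p + 1, q) := by
  obtain ⟨h1, h2, h3, h4, h5, h6⟩ := zmod_small_ne hn
  rw [carry_eq hb, hl]
  simp [Equiv.swap_apply_def, *]

theorem carry_front (hn : 4 ≤ n) (hb : x b = (p + 1, q)) {l : L} (hl : x l = (p + 2, q)) :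
    carry b x l = (p + 2, q + 1) := by
  obtain ⟨h1, h2, h3, h4, h5, h6⟩ := zmod_small_ne hn
  rw [carry_eq hb, hl]
  simp [Equiv.swap_apply_def, *]

theorem carry_front_up (hn : 4 ≤ n) (hb : x b = (p + 1, q)) {l : L} (hl : x l = (p + 2, q + 1)) :
    carry b x l = (p + 1, q + 1) := by
  obtain ⟨h1, h2, h3, h4, h5, h6⟩ := zmod_small_ne hn
  rw [carry_eq hb, hl]
  simp [Equiv.swap_apply_def, *]

theorem carry_far (hb : x b = (p + 1, q)) {l : L} (h0 : (x l).1 ≠ p)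
    (h1 : (x l).1 ≠ p + 1) (h2 : (x l).1 ≠ p + 2) : carry b x l = x l := by
  rw [carry_eq hb]
  generalize x l = y at *
  obtain ⟨y1, y2⟩ := y
  simp only at h0 h1 h2
  simp [Equiv.swap_apply_def, *]

theorem carry_iterate_hole (hb : x b = (p + 1, q)) (s : ℕ) :
    (carry b)^[s] x b = (p + s + 1, q) := by
  induction s with
  | zero => simpa using hb
  | succ s ih =>
    rw [Function.iterate_succ_apply', carry_hole ih]
    push_cast
    congr 1; ring

theorem carry_iterate_piece (hn : 4 ≤ n) (hb : x b = (p + 1, q)) {l : L} (hl : x l = (p, q))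
    (s : ℕ) : (carry b)^[s] x l = (p + s, q) := by
  induction s with
  | zero => simpa using hl
  | succ s ih =>
    rw [Function.iterate_succ_apply', carry_piece hn (carry_iterate_hole hb s) ih]
    push_cast
    congr 1; ring

theorem carry_iterate_far (hb : x b = (p + 1, q)) {l : L} {a s : ℕ} {r : ZMod n}
    (hl : x l = (p + a, r)) (ha : s + 2 ≤ a) (han : a < n) :
    (carry b)^[s] x l = (p + a, r) := by
  induction s with
  | zero => simpa using hl
  | succ s ih =>
    have h := ih (by omega)
    have key : ∀ j : ℕ, j < 3 → p + (a : ZMod n) ≠ p + (s : ZMod n) + (j : ZMod n) := fun j hj => by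
      rw [add_assoc, Ne, add_right_inj, ← Nat.cast_add]
      exact natCast_ne_natCast han (by omega) (by omega)
    rw [Function.iterate_succ_apply', carry_far (carry_iterate_hole hb s), h]
    · rw [h]; simpa using key 0 (by omega)
    · rw [h]; simpa using key 1 (by omega)
    · rw [h]; simpa using key 2 (by omega)

theorem carry_iterate_front (hn : 4 ≤ n) (hb : x b = (p + 1, q)) {l : L} {s : ℕ}
    (hs : s + 2 < n) (hl : x l = (p + (s + 2 : ℕ), q)) :
    (carry b)^[s + 1] x l = (p + (s + 2 : ℕ), q + 1) := by
  have h := carry_iterate_far hb hl le_rfl hs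
  rw [Function.iterate_succ_apply', carry_front hn (carry_iterate_hole hb s)]
  · push_cast; congr 1; ring
  · rw [h]; push_cast; congr 1; ring

theorem carry_iterate_front_up (hn : 4 ≤ n) (hb : x b = (p + 1, q)) {l : L} {s : ℕ}
    (hs : s + 2 < n) (hl : x l = (p + (s + 2 : ℕ), q + 1)) :
    (carry b)^[s + 1] x l = (p + (s + 1 : ℕ), q + 1) := by
  have h := carry_iterate_far hb hl le_rfl hs
  rw [Function.iterate_succ_apply', carry_front_up hn (carry_iterate_hole hb s)]
  · push_cast; congr 1; ring
  · rw [h]; push_cast; congr 1; ring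

theorem rotate_piece (hn : 4 ≤ n) (hb : x b = (p + 1, q)) {l : L} (hl : x l = (p, q)) :
    rotate b x l = (p + 1, q + 1) := by
  obtain ⟨h1, h2, h3, h4, h5, h6⟩ := zmod_small_ne hn
  rw [rotate_eq hb, hl]
  simp [Equiv.swap_apply_def, *]

theorem rotate_hole (hb : x b = (p + 1, q)) : rotate b x b = (p + 1, q) := by
  rw [rotate_eq hb]; simp [hb]

theorem rotate_other (hb : x b = (p + 1, q)) {l : L} (h1 : x l ≠ (p, q)) (h2 : x l ≠ (p + 1, q))
    (h3 : x l ≠ (p, q + 1)) (h4 : x l ≠ (p + 1, q + 1)) : rotate b x l = x l := by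
  rw [rotate_eq hb]
  rw [Equiv.swap_apply_of_ne_of_ne h2 h1, Equiv.swap_apply_of_ne_of_ne h1 h3,
    Equiv.swap_apply_of_ne_of_ne h3 h4, Equiv.swap_apply_of_ne_of_ne h4 h2]

/-- Carrying a piece next to its target, rotating and carrying back amounts to moving that piece
alone, provided the target and the square above it bear no label. -/
theorem rotate_carry_iterate [DecidableEq L] (hn : 4 ≤ n) (hx : Function.Injective x)
    (hb : x b = (p + 1, q)) {i : L} (hi : x i = (p, q)) {s : ℕ} (hs : s + 2 < n)
    (h1 : ∀ l, x l ≠ (p + (s + 2 : ℕ), q)) (h2 : ∀ l, x l ≠ (p + (s + 2 : ℕ), q + 1)) :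
    rotate b ((carry b)^[s + 1] x) =
      (carry b)^[s + 1] (Function.update x i (p + (s + 2 : ℕ), q)) := by
  have hib : b ≠ i := by
    rintro rfl
    rw [hb] at hi
    simp [(zmod_small_ne hn).1] at hi
  set x' := Function.update x i (p + (s + 2 : ℕ), q) with hx'
  have hb' : x' b = (p + 1, q) := by rw [hx', Function.update_of_ne hib, hb]
  have hole := carry_iterate_hole hb (s + 1)
  have hole' := carry_iterate_hole hb' (s + 1)
  have hcomp := carry_iterate_comp b (id : Board n → Board n) x (s + 1)
  have hcomp' := carry_iterate_comp b (id : Board n → Board n) x' (s + 1)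
  rw [Function.id_comp] at hcomp hcomp'
  rw [hb] at hcomp
  rw [hb'] at hcomp'
  have hinj : Function.Injective ((carry ((p + 1, q) : Board n))^[s + 1] id) :=
    Function.Injective.carry_iterate _ Function.injective_id _
  have f1 := carry_iterate_piece hn (b := ((p + 1, q) : Board n)) (x := id) rfl
    (l := (p, q)) rfl (s + 1)
  have f2 := carry_iterate_front hn (b := ((p + 1, q) : Board n)) (x := id) rfl
    (l := (p + (s + 2 : ℕ), q)) hs rfl
  have f3 := carry_iterate_front_up hn (b := ((p + 1, q) : Board n)) (x := id) rfl
    (l := (p + (s + 2 : ℕ), q + 1)) hs rfl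
  have e2 : (p + (s + 2 : ℕ) : ZMod n) = p + (s + 1 : ℕ) + 1 := by push_cast; ring
  funext l
  by_cases hli : l = i
  · subst hli
    rw [rotate_piece hn hole (carry_iterate_piece hn hb hi (s + 1)), hcomp']
    rw [Function.comp_apply, hx', Function.update_self, f2, e2]
  by_cases hlb : l = b
  · subst hlb
    rw [rotate_hole hole, hole']
  have hxl : (carry b)^[s + 1] x' l = (carry b)^[s + 1] x l := by
    rw [hcomp, hcomp', Function.comp_apply, Function.comp_apply, hx', Function.update_of_ne hli]
  rw [hxl]
  refine rotate_other hole ?_ ?_ ?_ ?_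
  · rw [hcomp, Function.comp_apply, ← f1]
    exact fun h => hli (hx ((hinj h).trans hi.symm))
  · rw [← hole]
    exact fun h => hlb (hx.carry_iterate b _ h)
  · rw [hcomp, Function.comp_apply, ← f3]
    exact fun h => h2 l (hinj h)
  · rw [hcomp, Function.comp_apply, ← e2, ← f2]
    exact fun h => h1 l (hinj h)

end Carry

section NearMove

theorem right_mem_displacements {n : ℕ} : ((1, 0) : Board n) ∈ displacements n :=
    by simp [displacements]
theorem left_mem_displacements {n : ℕ} : ((-1, 0) : Board n) ∈ displacements n :=
    by simp [displacements]
theorem up_mem_displacements {n : ℕ} : ((0, 1) : Board n) ∈ displacements n :=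
    by simp [displacements]
theorem down_mem_displacements {n : ℕ} : ((0, -1) : Board n) ∈ displacements n :=
    by simp [displacements]

theorem add_mk {n : ℕ} (w : Board n) (a b : ZMod n) : w + (a, b) = (w.1 + a, w.2 + b) := rfl

variable {n : ℕ} [NeZero n] {ι : Type} [Fintype ι] [DecidableEq ι]

theorem sum_sq_slide_comp_le (f : (Option ι → Board n) → ℝ) {d : Board n}
    (hd : d ∈ displacements n) {g : (Option ι → Board n) → Option ι → Board n}
    (hmaps : ∀ x ∈ placements n ι, g x ∈ placements n ι) (hinj : Function.Injective g) {c : ℝ}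
    (hc : ∑ x ∈ placements n ι, (f (g x) - f x) ^ 2 ≤ c * energy f) :
    ∑ x ∈ placements n ι, (f (slide none d (g x)) - f x) ^ 2 ≤ (2 + 2 * c) * energy f := by
  have h := sum_sq_comp_le f (g₁ := slide none d) hmaps hinj
  have h' := sum_sq_slide_le f hd
  linarith

theorem sum_sq_rotate_le (f : (Option ι → Board n) → ℝ) :
    ∑ x ∈ placements n ι, (f (rotate none x) - f x) ^ 2 ≤ 22 * energy f := by
  have i1 := slide_injective (n := n) (none : Option ι) (-1, 0)
  have i2 := (slide_injective (n := n) (none : Option ι) (0, 1)).comp i1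
  have i3 := (slide_injective (n := n) (none : Option ι) (1, 0)).comp i2
  have h1 := (sum_sq_slide_le f (left_mem_displacements (n := n))).trans_eq (one_mul _).symm
  have h2 := sum_sq_slide_comp_le f up_mem_displacements
    (fun x hx => slide_mem_placements hx) i1 h1
  have h3 := sum_sq_slide_comp_le f right_mem_displacements
    (fun x hx => slide_mem_placements (slide_mem_placements hx)) i2 h2
  have h4 := sum_sq_slide_comp_le f down_mem_displacements
    (fun x hx => slide_mem_placements (slide_mem_placements (slide_mem_placements hx))) i3 h3
  exact h4.trans_eq (by norm_num)

theorem sum_sq_carry_le (f : (Option ι → Board n) → ℝ) :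
    ∑ x ∈ placements n ι, (f (carry none x) - f x) ^ 2 ≤ 46 * energy f := by
  have i1 := slide_injective (n := n) (none : Option ι) (-1, 0)
  have i2 := (slide_injective (n := n) (none : Option ι) (0, 1)).comp i1
  have i3 := (slide_injective (n := n) (none : Option ι) (1, 0)).comp i2
  have i4 := (slide_injective (n := n) (none : Option ι) (1, 0)).comp i3
  have h1 := (sum_sq_slide_le f (left_mem_displacements (n := n))).trans_eq (one_mul _).symm
  have h2 := sum_sq_slide_comp_le f up_mem_displacements
    (fun x hx => slide_mem_placements hx) i1 h1
  have h3 := sum_sq_slide_comp_le f right_mem_displacements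
    (fun x hx => slide_mem_placements (slide_mem_placements hx)) i2 h2
  have h4 := sum_sq_slide_comp_le f right_mem_displacements
    (fun x hx => slide_mem_placements (slide_mem_placements (slide_mem_placements hx))) i3 h3
  have h5 := sum_sq_slide_comp_le f down_mem_displacements
    (fun x hx => slide_mem_placements (slide_mem_placements (slide_mem_placements
      (slide_mem_placements hx)))) i4 h4
  exact h5.trans_eq (by norm_num)

theorem carry_mem_placements {x : Option ι → Board n} (hx : x ∈ placements n ι) :
    carry none x ∈ placements n ι := by
  rw [mem_placements] at hx ⊢
  exact hx.carry _

theorem sum_sq_carry_iterate_le (f : (Option ι → Board n) → ℝ) (m : ℕ) :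
    ∑ x ∈ placements n ι, (f ((carry none)^[m] x) - f x) ^ 2 ≤ m ^ 2 * (46 * energy f) :=
  (sum_sq_iterate_le f m (fun _ hx => carry_mem_placements hx) (carry_injective _)).trans
    (mul_le_mul_of_nonneg_left (sum_sq_carry_le f) (by positivity))

theorem sq_sub_le_three (a b c d : ℝ) :
    (a - d) ^ 2 ≤ 3 * ((a - b) ^ 2 + (b - c) ^ 2 + (c - d) ^ 2) := by
  nlinarith [sq_nonneg ((a - b) - (b - c)), sq_nonneg ((b - c) - (c - d)),
    sq_nonneg ((a - b) - (c - d))]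

theorem sum_le_sum_of_injOn {X Y : Type*} {A : Finset X} {B : Finset Y} (g : X → Y) (φ : Y → ℝ)
    (hg : ∀ x ∈ A, g x ∈ B) (hinj : Set.InjOn g A) (hφ : ∀ y, 0 ≤ φ y) :
    ∑ x ∈ A, φ (g x) ≤ ∑ y ∈ B, φ y := by
  classical
  rw [← Finset.sum_image (f := φ) hinj]
  refine Finset.sum_le_sum_of_subset_of_nonneg ?_ fun _ _ _ => hφ _
  intro y hy
  obtain ⟨x, hx, rfl⟩ := Finset.mem_image.1 hy
  exact hg x hx

theorem Function.Injective.update_of_notMem {L Y : Type*} [DecidableEq L] {x : L → Y}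
    (hx : Function.Injective x) (i : L) {q : Y} (hq : ∀ l, l ≠ i → x l ≠ q) :
    Function.Injective (Function.update x i q) := by
  intro a c h
  by_cases ha : a = i <;> by_cases hc : c = i
  · rw [ha, hc]
  · subst ha; rw [Function.update_self, Function.update_of_ne hc] at h; exact absurd h.symm
      (hq c hc)
  · subst hc; rw [Function.update_self, Function.update_of_ne ha] at h; exact absurd h (hq a ha)
  · rw [Function.update_of_ne ha, Function.update_of_ne hc] at h; exact hx h

/-- Cost of moving a piece horizontally when the hole sits just to its right. -/
theorem sum_sq_near_move_le (hn : 4 ≤ n) (f : (Option ι → Board n) → ℝ) (i : ι)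
    {A : Finset (Option ι → Board n)} (hA : A ⊆ placements n ι) {s : ℕ} (hs : s + 2 < n)
    (hhole : ∀ y ∈ A, y none = y (some i) + (1, 0))
    (h1 : ∀ y ∈ A, ∀ l, y l ≠ y (some i) + (((s + 2 : ℕ) : ZMod n), 0))
    (h2 : ∀ y ∈ A, ∀ l, y l ≠ y (some i) + (((s + 2 : ℕ) : ZMod n), 1)) :
    ∑ y ∈ A, (f (Function.update y (some i) (y (some i) + (((s + 2 : ℕ) : ZMod n), 0))) - f y) ^ 2
      ≤ 400 * (s + 2 : ℕ) ^ 2 * energy f := by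
  set g : (Option ι → Board n) → Option ι → Board n := fun y =>
    Function.update y (some i) (y (some i) + (((s + 2 : ℕ) : ZMod n), 0)) with hg
  have hginj : Set.InjOn g A := by
    intro y hy y' hy' h
    have e0 : y none = y' none := by
      have := congrFun h none
      simpa [hg] using this
    have ei : y (some i) = y' (some i) := by
      rw [hhole y hy, hhole y' hy'] at e0
      exact add_right_cancel e0
    funext l
    by_cases hl : l = some i
    · rw [hl, ei]
    · have := congrFun h l
      simpa [hg, Function.update_of_ne hl] using this
  have hgmem : ∀ y ∈ A, g y ∈ placements n ι := fun y hy => by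
    have := hA hy
    rw [mem_placements] at this ⊢
    exact this.update_of_notMem _ fun l _ => h1 y hy l
  have key : ∀ y ∈ A, rotate none ((carry none)^[s + 1] y) = (carry none)^[s + 1] (g y) := by
    intro y hy
    have h := rotate_carry_iterate (b := (none : Option ι)) (x := y) (p := (y (some i)).1)
      (q := (y (some i)).2) hn (mem_placements.1 (hA hy)) (by rw [hhole y hy, add_mk, add_zero])
          (i := some i)
      rfl hs (fun l => by have := h1 y hy l; rwa [add_mk, add_zero] at this)
      (h2 y hy)
    simp only [h, hg, add_mk, add_zero]
  set c := (carry (n := n) (none : Option ι))^[s + 1] with hc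
  have hcinj : Function.Injective c := (carry_injective _).iterate _
  have hcmem : ∀ y ∈ placements n ι, c y ∈ placements n ι := fun y hy => by
    rw [mem_placements] at hy ⊢
    exact hy.carry_iterate _ _
  have t1 : ∑ y ∈ A, (f (g y) - f (c (g y))) ^ 2 ≤ ((s + 1 : ℕ) : ℝ) ^ 2 * (46 * energy f) := by
    refine (sum_le_sum_of_injOn g (fun y => (f y - f (c y)) ^ 2) hgmem hginj
      fun _ => sq_nonneg _).trans ?_
    refine le_trans (le_of_eq ?_) (sum_sq_carry_iterate_le f (s + 1))
    exact Finset.sum_congr rfl fun y _ => by rw [← hc]; ring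
  have t2 : ∑ y ∈ A, (f (rotate none (c y)) - f (c y)) ^ 2 ≤ 22 * energy f :=
    (sum_le_sum_of_injOn c (fun y => (f (rotate none y) - f y) ^ 2) (fun y hy => hcmem y (hA hy))
      hcinj.injOn fun _ => sq_nonneg _).trans (sum_sq_rotate_le f)
  have t3 : ∑ y ∈ A, (f (c y) - f y) ^ 2 ≤ ((s + 1 : ℕ) : ℝ) ^ 2 * (46 * energy f) :=
    (Finset.sum_le_sum_of_subset_of_nonneg hA fun _ _ _ => sq_nonneg _).trans
      (sum_sq_carry_iterate_le f (s + 1))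
  have t4 : ∑ y ∈ A, (f (g y) - f y) ^ 2 ≤ 3 * (∑ y ∈ A, (f (g y) - f (c (g y))) ^ 2 +
      ∑ y ∈ A, (f (rotate none (c y)) - f (c y)) ^ 2 + ∑ y ∈ A, (f (c y) - f y) ^ 2) := by
    rw [← Finset.sum_add_distrib, ← Finset.sum_add_distrib, Finset.mul_sum]
    refine Finset.sum_le_sum fun y hy => ?_
    rw [key y hy]
    exact sq_sub_le_three _ _ _ _
  refine t4.trans ?_
  have hE := energy_nonneg f
  push_cast at *
  have : 3 * ((s + 1 : ℝ) ^ 2 * 46 + 22 + (s + 1 : ℝ) ^ 2 * 46) ≤ 400 * (s + 2 : ℝ) ^ 2 := by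
    nlinarith [(Nat.cast_nonneg s : (0 : ℝ) ≤ s)]
  nlinarith [mul_le_mul_of_nonneg_right this hE]

end NearMove

section Transit

variable {n : ℕ} {L M : Type*}

/-- The hole, at position `z` relative to a piece, travels along the coordinate directions to
the square at the right of that piece, without touching it. -/
def transit (z : Board n) (b : L) (x : L → Board n) : L → Board n :=
  (slide b (0, -1))^[(if z.2 = 0 then 1 else z.2).val]
    ((slide b (-1, 0))^[(z.1 - 1).val] ((slide b (0, 1))^[if z.2 = 0 then 1 else 0] x))

theorem transit_comp (z : Board n) (c : M) (x : L → Board n) (y : M → L) :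
    transit z c (x ∘ y) = transit z (y c) x ∘ y := by
  simp only [transit, slide_iterate_comp]

theorem transit_injective (z : Board n) (b : L) :
    Function.Injective (transit z b : (L → Board n) → L → Board n) :=
  ((slide_injective _ _).iterate _).comp <|
    ((slide_injective _ _).iterate _).comp ((slide_injective _ _).iterate _)

theorem Function.Injective.slide_iterate (b : L) (d : Board n) {x : L → Board n}
    (hx : Function.Injective x) (j : ℕ) : Function.Injective ((_root_.slide b d)^[j] x) := by
  induction j with
  | zero => exact hx
  | succ j ih => rw [Function.iterate_succ_apply']; exact ih.slide b d

theorem Function.Injective.transit (z : Board n) (b : L) {x : L → Board n}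
    (hx : Function.Injective x) : Function.Injective (transit z b x) :=
  ((hx.slide_iterate _ _ _).slide_iterate _ _ _).slide_iterate _ _ _

theorem transit_hole [NeZero n] (z : Board n) (b : L) (x : L → Board n) :
    transit z b x b = x b - z + (1, 0) := by
  simp only [transit, slide_iterate_hole]
  by_cases h : z.2 = 0
  · rcases Nat.lt_or_ge 1 n with hn | hn
    · have : Fact (1 < n) := ⟨hn⟩
      ext <;> simp [h, ZMod.val_one]
      ring
    · have : n = 1 := le_antisymm hn (NeZero.pos n)
      subst this
      exact Subsingleton.elim _ _
  · ext <;> simp [h]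
    ring
    ring

theorem slide_iterate_of_sub_ne {x : L → Board n} {b l : L} {w d : Board n} (h : x b - x l = w)
    (m : ℕ) (hw : ∀ j ≤ m, w + j • d ≠ 0) : (slide b d)^[m] x l = x l :=
  slide_iterate_of_ne m fun i hi e => hw i hi (by rw [← h, e]; abel)

theorem slide_iterate_sub {x : L → Board n} {b l : L} {w d : Board n} (h : x b - x l = w)
    (m : ℕ) (hw : ∀ j ≤ m, w + j • d ≠ 0) :
    (slide b d)^[m] x b - (slide b d)^[m] x l = w + m • d := by
  rw [slide_iterate_of_sub_ne h m hw, slide_iterate_hole, ← h]; abel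

theorem transit_path_ne [NeZero n] (hn : 2 ≤ n) (z : Board n) {m : ZMod n} (hm : m ≠ 1)
    (hw : z - (m, 0) ≠ 0) :
    (∀ j ≤ if z.2 = 0 then 1 else 0, z - (m, 0) + j • ((0, 1) : Board n) ≠ 0) ∧
    (∀ j ≤ (z.1 - 1).val, z - (m, 0) + (if z.2 = 0 then 1 else 0) • ((0, 1) : Board n) +
      j • ((-1, 0) : Board n) ≠ 0) ∧
    (∀ j ≤ (if z.2 = 0 then 1 else z.2).val, z - (m, 0) +
      (if z.2 = 0 then 1 else 0) • ((0, 1) : Board n) + (z.1 - 1).val • ((-1, 0) : Board n) +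
      j • ((0, -1) : Board n) ≠ 0) := by
  have : Fact (1 < n) := ⟨hn⟩
  refine ⟨fun j hj => ?_, fun j _ h => ?_, fun j _ h => ?_⟩
  · by_cases h : z.2 = 0
    · rw [if_pos h] at hj
      interval_cases j
      · simpa using hw
      · intro e
        have := congrArg Prod.snd e
        simp [h] at this
    · rw [if_neg h] at hj
      obtain rfl : j = 0 := by omega
      simpa using hw
  · have := congrArg Prod.snd h
    by_cases hz : z.2 = 0 <;> simp [hz] at this
  · have := congrArg Prod.fst h
    by_cases hz : z.2 = 0 <;> simp [hz] at this <;> exact hm (by linear_combination -this)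

theorem transit_apply_of_sub [NeZero n] (hn : 2 ≤ n) {z : Board n} {m : ZMod n} (hm : m ≠ 1)
    (hw : z - (m, 0) ≠ 0) {x : L → Board n} {b l : L} (hx : x b - x l = z - (m, 0)) :
    transit z b x l = x l := by
  obtain ⟨h1, h2, h3⟩ := transit_path_ne hn z hm hw
  have e1 := slide_iterate_sub hx _ h1
  have e2 := slide_iterate_sub e1 _ h2
  rw [transit, slide_iterate_of_sub_ne e2 _ h3, slide_iterate_of_sub_ne e1 _ h2,
    slide_iterate_of_sub_ne hx _ h1]

theorem nsmul_unit_injective {i j : ℕ} (hi : i < n) (hj : j < n) {d : Board n}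
    (hd : d = (0, 1) ∨ d = (-1, 0) ∨ d = (0, -1) ∨ d = (1, 0)) (h : i • d = j • d) : i = j := by
  by_contra hne
  have := natCast_ne_natCast hi hj hne
  rcases hd with rfl | rfl | rfl | rfl <;> simp at h <;> exact this h

variable {ι : Type} [Fintype ι] [DecidableEq ι] [NeZero n]

theorem sum_sq_line_rel_le (f : (Option ι → Board n) → ℝ) {d : Board n}
    (hd : d ∈ displacements n) (hd' : d = (0, 1) ∨ d = (-1, 0) ∨ d = (0, -1) ∨ d = (1, 0))
    {A : Finset (Option ι → Board n)} (hA : A ⊆ placements n ι) {l : Option ι} {w : Board n}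
    {m : ℕ} (hmn : m ≤ n) (hrel : ∀ x ∈ A, x none - x l = w) (hw : ∀ j ≤ m, w + j • d ≠ 0) :
    ∑ x ∈ A, (f ((slide none d)^[m] x) - f x) ^ 2 ≤ m * energy f :=
  sum_sq_line_le f hd hA m w (fun x => x none - x l)
    (fun j hj x hx => slide_iterate_sub (hrel x hx) j fun i hi => hw i (hi.trans hj.le))
    fun _ hi _ hj h => nsmul_unit_injective (hi.trans_le hmn) (hj.trans_le hmn) hd' h

theorem sum_sq_transit_le (hn : 2 ≤ n) (f : (Option ι → Board n) → ℝ)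
    {A : Finset (Option ι → Board n)} (hA : A ⊆ placements n ι) {l : Option ι} {z : Board n}
    {m : ZMod n} (hm : m ≠ 1) (hw : z - (m, 0) ≠ 0)
    (hrel : ∀ x ∈ A, x none - x l = z - (m, 0)) :
    ∑ x ∈ A, (f (transit z none x) - f x) ^ 2 ≤ 9 * n * energy f := by
  classical
  obtain ⟨h1, h2, h3⟩ := transit_path_ne hn z hm hw
  have hn1 : (if z.2 = 0 then 1 else 0) ≤ n := by split_ifs <;> omega
  have hE := energy_nonneg f
  set g1 := (slide (n := n) (none : Option ι) (0, 1))^[if z.2 = 0 then 1 else 0] with hg1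
  set g2 := (slide (n := n) (none : Option ι) (-1, 0))^[(z.1 - 1).val] with hg2
  set g3 := (slide (n := n) (none : Option ι) (0, -1))^[(if z.2 = 0 then 1 else z.2).val] with hg3
  have i1 : Function.Injective g1 := (slide_injective _ _).iterate _
  have i2 : Function.Injective g2 := (slide_injective _ _).iterate _
  have r1 : ∀ x ∈ A.image g1, x none - x l = z - (m, 0) + (if z.2 = 0 then 1 else 0) •
      ((0, 1) : Board n) := by
    intro y hy
    obtain ⟨x, hx, rfl⟩ := Finset.mem_image.1 hy
    exact slide_iterate_sub (hrel x hx) _ h1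
  have r2 : ∀ x ∈ (A.image g1).image g2, x none - x l = z - (m, 0) +
      (if z.2 = 0 then 1 else 0) • ((0, 1) : Board n) + (z.1 - 1).val • ((-1, 0) : Board n) := by
    intro y hy
    obtain ⟨x, hx, rfl⟩ := Finset.mem_image.1 hy
    exact slide_iterate_sub (r1 x hx) _ h2
  have s1 : A.image g1 ⊆ placements n ι := by
    intro y hy
    obtain ⟨x, hx, rfl⟩ := Finset.mem_image.1 hy
    exact slide_iterate_mem_placements _ (hA hx)
  have s2 : (A.image g1).image g2 ⊆ placements n ι := by
    intro y hy
    obtain ⟨x, hx, rfl⟩ := Finset.mem_image.1 hy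
    exact slide_iterate_mem_placements _ (s1 hx)
  have t1 := sum_sq_line_rel_le f up_mem_displacements (by simp) hA hn1 hrel h1
  have t2 := sum_sq_line_rel_le f left_mem_displacements (by simp) s1
    (ZMod.val_lt (z.1 - 1)).le r1 h2
  have t3 := sum_sq_line_rel_le f down_mem_displacements (by simp) s2
    (ZMod.val_lt (if z.2 = 0 then 1 else z.2)).le r2 h3
  rw [Finset.sum_image i1.injOn] at t2
  rw [Finset.sum_image i2.injOn, Finset.sum_image i1.injOn] at t3
  have t4 : ∑ x ∈ A, (f (transit z none x) - f x) ^ 2 ≤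
      3 * (∑ x ∈ A, (f (g3 (g2 (g1 x))) - f (g2 (g1 x))) ^ 2 +
        ∑ x ∈ A, (f (g2 (g1 x)) - f (g1 x)) ^ 2 + ∑ x ∈ A, (f (g1 x) - f x) ^ 2) := by
    rw [← Finset.sum_add_distrib, ← Finset.sum_add_distrib, Finset.mul_sum]
    exact Finset.sum_le_sum fun y hy => sq_sub_le_three _ _ _ _
  have b (m : ℕ) (h : m ≤ n) : (m : ℝ) * energy f ≤ n * energy f :=
    mul_le_mul_of_nonneg_right (by exact_mod_cast h) hE
  have b1 := t1.trans (b _ hn1)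
  have b2 := t2.trans (b _ (ZMod.val_lt (z.1 - 1)).le)
  have b3 := t3.trans (b _ (ZMod.val_lt (if z.2 = 0 then 1 else z.2)).le)
  linarith

theorem transit_mem_placements (z : Board n) {x : Option ι → Board n} (hx : x ∈ placements n ι) :
    transit z none x ∈ placements n ι := by
  rw [mem_placements] at hx ⊢
  exact hx.transit _ _

/-- Moving a piece to the right, for a given position `z` of the hole relative to the piece. -/
theorem sum_sq_move_fiber_le (hn : 4 ≤ n) (f : (Option ι → Board n) → ℝ) (i : ι)
    {A : Finset (Option ι → Board n)} (hA : A ⊆ placements n ι) {s : ℕ} (hs : s + 2 < n)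
    {z : Board n} (hz : ∀ x ∈ A, x none - x (some i) = z)
    (h1 : ∀ x ∈ A, ∀ l, x l ≠ x (some i) + (((s + 2 : ℕ) : ZMod n), 0))
    (h2 : ∀ x ∈ A, ∀ l, transit z none x l ≠ x (some i) + (((s + 2 : ℕ) : ZMod n), 1)) :
    ∑ x ∈ A, (f (Function.update x (some i) (x (some i) + (((s + 2 : ℕ) : ZMod n), 0))) - f x) ^ 2
      ≤ 1200 * (n + (s + 2 : ℕ) ^ 2) * energy f := by
  classical
  rcases A.eq_empty_or_nonempty with rfl | ⟨x₀, hx₀⟩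
  · simp only [Finset.sum_empty]
    have := energy_nonneg f
    positivity
  set m : ZMod n := ((s + 2 : ℕ) : ZMod n) with hmdef
  have hm1 : m ≠ 1 := by
    have := natCast_ne_natCast (n := n) (a := s + 2) (c := 1) hs (by omega) (by omega)
    rwa [Nat.cast_one] at this
  have hm0 : m ≠ 0 := by
    have := natCast_ne_natCast (n := n) (a := s + 2) (c := 0) hs (by omega) (by omega)
    rwa [Nat.cast_zero] at this
  have hz0 : z ≠ 0 := by
    rw [← hz x₀ hx₀, Ne, sub_eq_zero]
    intro h
    have := mem_placements.1 (hA hx₀) h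
    simp at this
  have hzm : z - (m, 0) ≠ 0 := by
    rw [Ne, sub_eq_zero, ← hz x₀ hx₀, sub_eq_iff_eq_add']
    exact h1 x₀ hx₀ none
  have h01 : (0 : ZMod n) ≠ 1 := (zmod_small_ne hn).2.2.2.1
  have ez : z - ((0 : ZMod n), (0 : ZMod n)) = z := sub_zero z
  have hz0' : z - ((0 : ZMod n), (0 : ZMod n)) ≠ 0 := by rwa [ez]
  set g : (Option ι → Board n) → Option ι → Board n := fun x =>
    Function.update x (some i) (x (some i) + (m, 0)) with hg
  set t := transit (n := n) z (none : Option ι) with ht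
  have htx : ∀ x ∈ A, t x (some i) = x (some i) := fun x hx =>
    transit_apply_of_sub (by omega) h01 hz0' (by rw [ez]; exact hz x hx)
  have hgn : ∀ x, g x none = x none := fun x => by simp [hg]
  have hgi : ∀ x, g x (some i) = x (some i) + (m, 0) := fun x => by simp [hg]
  have hgrel : ∀ x ∈ A, g x none - g x (some i) = z - (m, 0) := fun x hx => by
    rw [hgn, hgi, ← hz x hx]; abel
  have htgx : ∀ x ∈ A, t (g x) (some i) = x (some i) + (m, 0) := fun x hx => by
    rw [ht, transit_apply_of_sub (by omega) hm1 hzm (hgrel x hx), hgi]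
  have htg : ∀ x ∈ A, t (g x) = Function.update (t x) (some i) (t x (some i) + (m, 0)) := by
    intro x hx
    funext l
    by_cases hl : l = some i
    · subst hl
      rw [htgx x hx, Function.update_self, htx x hx]
    · rw [Function.update_of_ne hl]
      have e1 := congrFun (transit_comp z (none : Option ι) (id : Board n → Board n) x) l
      have e2 := congrFun (transit_comp z (none : Option ι) (id : Board n → Board n) (g x)) l
      rw [Function.id_comp] at e1 e2
      rw [ht, e1, e2, Function.comp_apply, Function.comp_apply, hgn]
      congr 1
      rw [hg]; exact Function.update_of_ne hl _ _
  have hginj : Set.InjOn g A := by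
    intro y hy y' hy' h
    have e0 : y none = y' none := by rw [← hgn y, h, hgn]
    have ei : y (some i) = y' (some i) := by
      have a1 := hz y hy
      rw [← hz y' hy', e0] at a1
      exact sub_right_injective a1
    funext l
    by_cases hl : l = some i
    · rw [hl, ei]
    · have := congrFun h l
      simpa [hg, Function.update_of_ne hl] using this
  have hgmem : ∀ y ∈ A, g y ∈ placements n ι := fun y hy => by
    have := hA hy
    rw [mem_placements] at this ⊢
    exact this.update_of_notMem _ fun l _ => h1 y hy l
  have htinj : Function.Injective t := transit_injective _ _
  have p1 : ∑ x ∈ A, (f (g x) - f (t (g x))) ^ 2 ≤ 9 * n * energy f := by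
    have h := sum_sq_transit_le (by omega) f (A := A.image g) (l := some i) (z := z)
      (Finset.image_subset_iff.2 hgmem) hm1 hzm (by
        intro y hy
        obtain ⟨x, hx, rfl⟩ := Finset.mem_image.1 hy
        exact hgrel x hx)
    rw [Finset.sum_image hginj] at h
    refine le_trans (le_of_eq ?_) h
    exact Finset.sum_congr rfl fun x _ => by rw [← ht]; ring
  have p3 : ∑ x ∈ A, (f (t x) - f x) ^ 2 ≤ 9 * n * energy f :=
    sum_sq_transit_le (by omega) f hA h01 hz0' (fun x hx => by rw [ez]; exact hz x hx)
  have p2 : ∑ x ∈ A, (f (t (g x)) - f (t x)) ^ 2 ≤ 400 * (s + 2 : ℕ) ^ 2 * energy f := by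
    have h := sum_sq_near_move_le hn f i (A := A.image t)
      (Finset.image_subset_iff.2 fun x hx => transit_mem_placements _ (hA hx)) hs
      (by
        intro y hy
        obtain ⟨x, hx, rfl⟩ := Finset.mem_image.1 hy
        rw [htx x hx, ht, transit_hole, ← hz x hx]
        abel)
      (by
        intro y hy l hl
        obtain ⟨x, hx, rfl⟩ := Finset.mem_image.1 hy
        by_cases hli : l = some i
        · subst hli
          rw [← hmdef] at hl
          have := congrArg Prod.fst hl
          simp at this
          exact hm0 this
        · have hh := (Function.Injective.transit z none (mem_placements.1 (hgmem x hx)))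
          apply hli
          apply hh
          have e : t (g x) l = t x l := by rw [htg x hx, Function.update_of_ne hli]
          rw [← ht, e, hl, htgx x hx, htx x hx])
      (by
        intro y hy l
        obtain ⟨x, hx, rfl⟩ := Finset.mem_image.1 hy
        rw [htx x hx]
        exact h2 x hx l)
    rw [Finset.sum_image htinj.injOn] at h
    refine le_trans (le_of_eq ?_) h
    exact Finset.sum_congr rfl fun x hx => by rw [htg x hx]
  have p4 : ∑ x ∈ A, (f (g x) - f x) ^ 2 ≤
      3 * (∑ x ∈ A, (f (g x) - f (t (g x))) ^ 2 + ∑ x ∈ A, (f (t (g x)) - f (t x)) ^ 2 +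
        ∑ x ∈ A, (f (t x) - f x) ^ 2) := by
    rw [← Finset.sum_add_distrib, ← Finset.sum_add_distrib, Finset.mul_sum]
    exact Finset.sum_le_sum fun y hy => sq_sub_le_three _ _ _ _
  refine p4.trans ?_
  have hE := energy_nonneg f
  have : 0 ≤ (n : ℝ) * energy f := by positivity
  linarith

end Transit

section Moves

variable {n : ℕ} {L : Type*}

theorem comp_slide (φ : Board n ≃+ Board n) (b : L) (d : Board n) (x : L → Board n) :
    φ ∘ slide b d x = slide b (φ d) (φ ∘ x) := by
  funext l
  simp only [Function.comp_apply, slide, φ.injective.map_swap, map_add]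

/-- The automorphism of the board exchanging the coordinates if `e` holds and then negating the
first one if `s` holds. -/
def axisEquiv (n : ℕ) (e s : Bool) : Board n ≃+ Board n :=
  (bif e then AddEquiv.prodComm else AddEquiv.refl _).trans
    (AddEquiv.prodCongr (bif s then AddEquiv.neg _ else AddEquiv.refl _) (AddEquiv.refl _))

theorem axisEquiv_apply (e s : Bool) (a b : ZMod n) : axisEquiv n e s (a, b) =
    (bif s then -(bif e then b else a) else bif e then b else a, bif e then a else b) := by
  cases e <;> cases s <;> rfl

theorem axisEquiv_mem_displacements (e s : Bool) (d : Board n) :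
    axisEquiv n e s d ∈ displacements n ↔ d ∈ displacements n := by
  obtain ⟨a, b⟩ := d
  cases e <;> cases s <;> 
    simp only [axisEquiv_apply, displacements, Finset.mem_insert, Finset.mem_singleton,
      Prod.mk.injEq, cond_true, cond_false, neg_eq_iff_eq_neg, neg_zero, neg_neg] <;> grind

/-- The displacement `v` along the axis `e`. -/
def axis (e : Bool) (v : ZMod n) : Board n := bif e then (0, v) else (v, 0)

theorem axisEquiv_symm_apply (e s : Bool) (m : ZMod n) :
    (axisEquiv n e s).symm (m, 0) = axis e (bif s then -m else m) := by
  rw [AddEquiv.symm_apply_eq]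
  cases e <;> cases s <;> simp [axisEquiv_apply, axis]

variable [NeZero n] {ι : Type} [Fintype ι] [DecidableEq ι]

theorem energy_comp (φ : Board n ≃+ Board n) (hφ : ∀ d, φ d ∈ displacements n ↔ d ∈ displacements n)
    (f : (Option ι → Board n) → ℝ) : energy (fun x => f (φ.symm ∘ x)) = energy f := by
  unfold energy
  have hφ' : ∀ d, φ.symm d ∈ displacements n ↔ d ∈ displacements n := fun d => by
    rw [← hφ, φ.apply_symm_apply]
  refine Finset.sum_bij' (fun x _ => φ.symm ∘ x) (fun x _ => φ ∘ x) ?_ ?_ ?_ ?_ ?_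
  · intro x hx
    rw [mem_placements] at hx ⊢
    exact φ.symm.injective.comp hx
  · intro x hx
    rw [mem_placements] at hx ⊢
    exact φ.injective.comp hx
  · intro x _; funext l; simp
  · intro x _; funext l; simp
  · intro x _
    refine Finset.sum_bij' (fun d _ => φ.symm d) (fun d _ => φ d) ?_ ?_ ?_ ?_ ?_
    · exact fun d hd => (hφ' d).2 hd
    · exact fun d hd => (hφ d).2 hd
    · simp
    · simp
    · intro d _; simp only [comp_slide]

/-- The piece `i` can be moved by `(m, 0)` in `x` by a detour of the hole along the board. -/
def Movable (x : Option ι → Board n) (i : ι) (m : ℕ) : Prop :=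
  (∀ l, x l ≠ x (some i) + ((m : ZMod n), 0)) ∧
    ∀ l, transit (x none - x (some i)) none x l ≠ x (some i) + ((m : ZMod n), 1)

open Classical in
theorem sum_sq_move_right_le (hn : 4 ≤ n) (f : (Option ι → Board n) → ℝ) (i : ι) {m : ℕ}
    (hm : 2 ≤ m) (hmn : m < n) :
    ∑ x ∈ (placements n ι).filter fun x => Movable x i m,
      (f (Function.update x (some i) (x (some i) + ((m : ZMod n), 0))) - f x) ^ 2 ≤
        1200 * n ^ 2 * (n + m ^ 2) * energy f := by
  obtain ⟨s, rfl⟩ := Nat.exists_eq_add_of_le' hm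
  rw [← Finset.sum_fiberwise_of_maps_to (s := (placements n ι).filter fun x => Movable x i (s + 2))
    (t := (Finset.univ : Finset (Board n))) (g := fun x => x none - x (some i))
    fun _ _ => Finset.mem_univ _]
  have h : ∀ z ∈ (Finset.univ : Finset (Board n)), ∑ x ∈ ((placements n ι).filter
      fun x => Movable x i (s + 2)).filter (fun x => x none - x (some i) = z),
      (f (Function.update x (some i) (x (some i) + (((s + 2 : ℕ) : ZMod n), 0))) - f x) ^ 2 ≤
        1200 * (n + (s + 2 : ℕ) ^ 2) * energy f := by
    intro z _
    refine sum_sq_move_fiber_le hn f i ?_ hmn (z := z) ?_ ?_ ?_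
    · exact (Finset.filter_subset _ _).trans (Finset.filter_subset _ _)
    · exact fun x hx => (Finset.mem_filter.1 hx).2
    · exact fun x hx => (Finset.mem_filter.1 (Finset.mem_filter.1 hx).1).2.1
    · intro x hx
      obtain ⟨hx1, rfl⟩ := Finset.mem_filter.1 hx
      exact (Finset.mem_filter.1 hx1).2.2
  refine (Finset.sum_le_sum h).trans (le_of_eq ?_)
  rw [Finset.sum_const, Finset.card_univ, Fintype.card_prod, ZMod.card, nsmul_eq_mul]
  push_cast
  ring

open Classical in
theorem sum_sq_move_axis_le (hn : 4 ≤ n) (f : (Option ι → Board n) → ℝ) (i : ι) {m : ℕ}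
    (hm : 2 ≤ m) (hmn : m < n) (e s : Bool) :
    ∑ x ∈ (placements n ι).filter fun x => Movable (axisEquiv n e s ∘ x) i m,
      (f (Function.update x (some i) (x (some i) + axis e (bif s then -(m : ZMod n) else m))) -
        f x) ^ 2 ≤ 1200 * n ^ 2 * (n + m ^ 2) * energy f := by
  set φ := axisEquiv n e s with hφ
  rw [← energy_comp φ (axisEquiv_mem_displacements e s) f]
  refine le_trans (le_of_eq ?_)
    (sum_sq_move_right_le hn (fun x => f (φ.symm ∘ x)) i hm hmn)
  refine Finset.sum_bij' (fun x _ => φ ∘ x) (fun x _ => φ.symm ∘ x) ?_ ?_ ?_ ?_ ?_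
  · intro x hx
    rw [Finset.mem_filter, mem_placements] at hx ⊢
    exact ⟨φ.injective.comp hx.1, hx.2⟩
  · intro x hx
    rw [Finset.mem_filter, mem_placements] at hx ⊢
    refine ⟨φ.symm.injective.comp hx.1, ?_⟩
    convert hx.2
    funext l; simp
  · intro x _; funext l; simp
  · intro x _; funext l; simp
  · intro x _
    congr 3
    · funext l
      by_cases hl : l = some i
      · subst hl
        simp [← axisEquiv_symm_apply, φ]
      · simp [Function.update_of_ne hl]
    · funext l; simp

theorem card_natCast_eq_le_one {c : Finset ℕ} (hc : ∀ m ∈ c, m < n) {w : Board n} {b : ZMod n}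
    (h : ∀ m ∈ c, w = ((m : ZMod n), b)) : #c ≤ 1 := by
  rw [Finset.card_le_one]
  intro a ha a' ha'
  by_contra hne
  have := (h a ha).symm.trans (h a' ha')
  exact natCast_ne_natCast (hc a ha) (hc a' ha') hne (congrArg Prod.fst this)

open Classical in
theorem card_not_movable_le (x : Option ι → Board n) (i : ι) :
    #((Finset.range n).filter fun m => ¬ Movable x i m) ≤ 2 * (Fintype.card ι + 1) := by
  have hsub : ((Finset.range n).filter fun m => ¬ Movable x i m) ⊆
      (Finset.univ : Finset (Option ι × Bool)).biUnion fun l => (Finset.range n).filter fun m =>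
        bif l.2 then x l.1 = x (some i) + ((m : ZMod n), 0)
        else transit (x none - x (some i)) none x l.1 = x (some i) + ((m : ZMod n), 1) := by
    intro m hm
    rw [Finset.mem_filter, Movable, not_and_or] at hm
    push Not at hm
    simp only [Finset.mem_biUnion, Finset.mem_univ, true_and, Finset.mem_filter, Prod.exists,
      Bool.exists_bool]
    rcases hm with ⟨h, ⟨l, hl⟩ | ⟨l, hl⟩⟩
    · exact ⟨l, Or.inr ⟨h, hl⟩⟩
    · exact ⟨l, Or.inl ⟨h, hl⟩⟩
  refine (Finset.card_le_card hsub).trans ((Finset.card_biUnion_le_card_mul _ _ 1 ?_).trans ?_)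
  · rintro ⟨l, e⟩ _
    cases e
    · refine card_natCast_eq_le_one
        (w := transit (x none - x (some i)) none x l - x (some i)) (b := 1) ?_ ?_
      · exact fun m hm => Finset.mem_range.1 (Finset.mem_filter.1 hm).1
      · intro m hm
        have := (Finset.mem_filter.1 hm).2
        rw [sub_eq_iff_eq_add']; exact this
    · refine card_natCast_eq_le_one (w := x l - x (some i)) (b := 0) ?_ ?_
      · exact fun m hm => Finset.mem_range.1 (Finset.mem_filter.1 hm).1
      · intro m hm
        have := (Finset.mem_filter.1 hm).2
        rw [sub_eq_iff_eq_add']; exact this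
  · rw [Finset.card_univ, Fintype.card_prod, Fintype.card_option, Fintype.card_bool]
    omega

end Moves

section Coordinates

variable {n : ℕ} {ι : Type}

/-- The coordinate of the piece `c.1` along the axis `c.2`. -/
def coord (x : Option ι → Board n) (c : ι × Bool) : ZMod n :=
  bif c.2 then (x (some c.1)).2 else (x (some c.1)).1

theorem placement_ext {x y : Option ι → Board n} (h : x none = y none)
    (hc : ∀ c, coord x c = coord y c) : x = y := by
  funext l
  cases l with
  | none => exact h
  | some i => exact Prod.ext (hc (i, false)) (hc (i, true))

variable [DecidableEq ι]

/-- Replace one coordinate of one piece. -/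
def setCoord (x : Option ι → Board n) (c : ι × Bool) (v : ZMod n) : Option ι → Board n :=
  Function.update x (some c.1)
    (bif c.2 then ((x (some c.1)).1, v) else (v, (x (some c.1)).2))

variable (x : Option ι → Board n) (c : ι × Bool) (v w : ZMod n)

@[simp] theorem setCoord_none : setCoord x c v none = x none := by simp [setCoord]

@[simp] theorem coord_setCoord_self : coord (setCoord x c v) c = v := by
  obtain ⟨i, e⟩ := c
  cases e <;> simp [setCoord, coord]

variable {c} in
theorem coord_setCoord_of_ne {c' : ι × Bool} (h : c' ≠ c) :
    coord (setCoord x c v) c' = coord x c' := by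
  obtain ⟨i, e⟩ := c
  obtain ⟨i', e'⟩ := c'
  by_cases hi : i' = i
  · subst hi
    cases e <;> cases e' <;> simp [setCoord, coord] at h ⊢
  · simp [setCoord, coord, hi]

@[simp] theorem setCoord_setCoord : setCoord (setCoord x c v) c w = setCoord x c w := by
  refine placement_ext (by simp) fun c' => ?_
  by_cases h : c' = c
  · subst h; simp
  · simp [coord_setCoord_of_ne _ _ h]

@[simp] theorem setCoord_coord : setCoord x c (coord x c) = x := by
  refine placement_ext (by simp) fun c' => ?_
  by_cases h : c' = c
  · subst h; simp
  · simp [coord_setCoord_of_ne _ _ h]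

/-- The distance between the representatives of `v` and of a coordinate of `x`. -/
def gap : ℕ := (v.val - (coord x c).val) + ((coord x c).val - v.val)

/-- Whether `v` has a smaller representative than a coordinate of `x`. -/
def below : Bool := decide (v.val < (coord x c).val)

theorem signed_gap [NeZero n] :
    coord x c + (bif below x c v then -(gap x c v : ZMod n) else (gap x c v : ZMod n)) = v := by
  by_cases h : v.val < (coord x c).val
  · have h1 : gap x c v = (coord x c).val - v.val := by unfold gap; omega
    rw [below, decide_eq_true h, h1, Nat.cast_sub h.le]
    simp
  · have h1 : gap x c v = v.val - (coord x c).val := by unfold gap; omega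
    rw [below, decide_eq_false h, h1, Nat.cast_sub (not_lt.1 h)]
    simp

theorem setCoord_eq [NeZero n] : setCoord x c v = Function.update x (some c.1)
    (x (some c.1) + axis c.2 (bif below x c v then -(gap x c v : ZMod n) else gap x c v)) := by
  have h := signed_gap x c v
  obtain ⟨i, e⟩ := c
  rw [setCoord]
  congr 1
  cases e
  · simp only [coord, cond_false] at h
    simp only [cond_false, axis, add_mk, h, add_zero]
  · simp only [coord, cond_true] at h
    simp only [cond_true, axis, add_mk, h, add_zero]

variable [NeZero n] [Fintype ι] {B : Type} [DecidableEq B] (blk : ZMod n → B)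

open Classical in
/-- The values in the block of a coordinate of `x` to which this coordinate can be moved. -/
noncomputable def reachable : Finset (ZMod n) :=
  Finset.univ.filter fun v => blk v = blk (coord x c) ∧ 2 ≤ gap x c v ∧
    Movable (axisEquiv n c.2 (below x c v) ∘ x) c.1 (gap x c v)

variable {blk x c v w}

theorem blk_of_mem_reachable (h : v ∈ reachable x c blk) : blk v = blk (coord x c) := by
  classical
  exact (Finset.mem_filter.1 h).2.1

theorem setCoord_mem_placements (hx : x ∈ placements n ι) (h : v ∈ reachable x c blk) :
    setCoord x c v ∈ placements n ι := by
  classical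
  rw [mem_placements] at hx ⊢
  rw [setCoord_eq]
  refine hx.update_of_notMem _ fun l _ hl => ?_
  refine (Finset.mem_filter.1 h).2.2.2.1 l ?_
  simp only [Function.comp_apply]
  rw [hl, map_add, ← axisEquiv_symm_apply, AddEquiv.apply_symm_apply]

theorem gap_lt : gap x c v < n := by
  have := ZMod.val_lt v
  have := ZMod.val_lt (coord x c)
  unfold gap; omega

theorem gap_below_injective (h : gap x c v = gap x c w) (h' : below x c v = below x c w) :
    v = w := by
  rw [← signed_gap x c v, h, h', signed_gap]

theorem card_block_sdiff_reachable_le (x : Option ι → Board n) (c : ι × Bool) :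
    #((Finset.univ.filter fun v => blk v = blk (coord x c)) \ reachable x c blk) ≤
      4 * Fintype.card ι + 8 := by
  classical
  set T : Bool → Finset ℕ := fun s =>
    {0, 1} ∪ (Finset.range n).filter fun m => ¬ Movable (axisEquiv n c.2 s ∘ x) c.1 m
  have hT : ∀ s, #(T s) ≤ 2 * Fintype.card ι + 4 := fun s => by
    have h1 := Finset.card_union_le ({0, 1} : Finset ℕ)
      ((Finset.range n).filter fun m => ¬ Movable (axisEquiv n c.2 s ∘ x) c.1 m)
    have h2 := card_not_movable_le (axisEquiv n c.2 s ∘ x) c.1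
    have h3 : #({0, 1} : Finset ℕ) = 2 := rfl
    change #({0, 1} ∪ _) ≤ _
    omega
  have hcard : #((Finset.univ : Finset Bool).sigma T) ≤ 4 * Fintype.card ι + 8 := by
    rw [Finset.card_sigma, Fintype.sum_bool]
    have := hT true
    have := hT false
    omega
  refine (Finset.card_le_card_of_injOn (fun v => (⟨below x c v, gap x c v⟩ : Σ _ : Bool, ℕ))
    ?_ ?_).trans hcard
  · intro v hv
    simp only [Finset.coe_sdiff, Finset.coe_filter, Set.mem_sdiff, Set.mem_ofPred_eq,
      Finset.mem_univ, true_and, Finset.mem_coe, reachable, Finset.mem_filter] at hv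
    simp only [T, Finset.coe_sigma, Set.mem_sigma_iff, Finset.mem_coe, Finset.mem_univ, true_and,
      Finset.mem_union, Finset.mem_insert, Finset.mem_singleton, Finset.mem_filter,
      Finset.mem_range]
    by_cases h2 : 2 ≤ gap x c v
    · exact Or.inr ⟨gap_lt, fun hm => hv.2 ⟨hv.1, h2, hm⟩⟩
    · left; omega
  · intro v _ w _ h
    simp only [Sigma.mk.injEq, heq_eq_eq] at h
    exact gap_below_injective h.2 h.1

theorem sum_sq_setCoord_le (hn : 4 ≤ n) (f : (Option ι → Board n) → ℝ) {ℓ : ℕ}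
    (hclose : ∀ v w, blk v = blk w → v.val < w.val + 2 * ℓ) (c : ι × Bool) :
    ∑ x ∈ placements n ι, ∑ v ∈ reachable x c blk, (f (setCoord x c v) - f x) ^ 2 ≤
      4800 * ℓ * n ^ 2 * (n + 4 * ℓ ^ 2) * energy f := by
  classical
  rw [Finset.sum_sigma']
  set T : Finset (Σ _ : Bool × ℕ, Option ι → Board n) :=
    ((Finset.univ : Finset Bool) ×ˢ (Finset.range (2 * ℓ)).filter fun m => 2 ≤ m ∧ m < n).sigma
      fun q => (placements n ι).filter fun x => Movable (axisEquiv n c.2 q.1 ∘ x) c.1 q.2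
  have h1 := sum_le_sum_of_injOn (A := (placements n ι).sigma fun x => reachable x c blk) (B := T)
    (fun q => ⟨(below q.1 c q.2, gap q.1 c q.2), q.1⟩)
    (fun q => (f (Function.update q.2 (some c.1) (q.2 (some c.1) + axis c.2
      (bif q.1.1 then -(q.1.2 : ZMod n) else q.1.2))) - f q.2) ^ 2) (by
      rintro ⟨x, v⟩ hq
      obtain ⟨hx, hv⟩ := Finset.mem_sigma.1 hq
      have hv' := (Finset.mem_filter.1 hv).2
      have a1 := hclose _ _ hv'.1
      have a2 := hclose _ _ hv'.1.symm
      simp only [T, Finset.mem_sigma, Finset.mem_product, Finset.mem_univ, true_and,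
        Finset.mem_filter, Finset.mem_range]
      refine ⟨⟨?_, hv'.2.1, gap_lt⟩, hx, hv'.2.2⟩
      simp only at a1 a2
      unfold gap; omega) (by
      rintro ⟨x, v⟩ _ ⟨y, w⟩ _ h
      simp only [Sigma.mk.injEq, Prod.mk.injEq, heq_eq_eq] at h
      obtain ⟨⟨h1, h2⟩, rfl⟩ := h
      rw [gap_below_injective h2 h1]) fun _ => sq_nonneg _
  refine (le_of_eq ?_).trans (h1.trans ?_)
  · exact Finset.sum_congr rfl fun q _ => by rw [setCoord_eq]
  rw [Finset.sum_sigma]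
  have h2 : ∀ q ∈ (Finset.univ : Finset Bool) ×ˢ (Finset.range (2 * ℓ)).filter
      (fun m => 2 ≤ m ∧ m < n), ∑ x ∈ (placements n ι).filter
        (fun x => Movable (axisEquiv n c.2 q.1 ∘ x) c.1 q.2),
      (f (Function.update x (some c.1) (x (some c.1) + axis c.2
        (bif q.1 then -(q.2 : ZMod n) else q.2))) - f x) ^ 2 ≤
      1200 * n ^ 2 * (n + 4 * ℓ ^ 2) * energy f := by
    rintro ⟨s, m⟩ hq
    simp only [Finset.mem_product, Finset.mem_univ, true_and, Finset.mem_filter,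
      Finset.mem_range] at hq
    refine (sum_sq_move_axis_le hn f c.1 hq.2.1 hq.2.2 c.2 s).trans ?_
    have : (m : ℝ) ≤ 2 * ℓ := by exact_mod_cast hq.1.le
    have : (m : ℝ) ^ 2 ≤ 4 * ℓ ^ 2 := by nlinarith [(Nat.cast_nonneg m : (0 : ℝ) ≤ m)]
    have hE := energy_nonneg f
    gcongr
  refine (Finset.sum_le_card_nsmul _ _ _ h2).trans ?_
  rw [nsmul_eq_mul, Finset.card_product, Finset.card_univ, Fintype.card_bool]
  have h3 : (((2 * #((Finset.range (2 * ℓ)).filter fun m => 2 ≤ m ∧ m < n)) : ℕ) : ℝ) ≤ 4 * ℓ := by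
    have := Finset.card_filter_le (Finset.range (2 * ℓ)) fun m => 2 ≤ m ∧ m < n
    rw [Finset.card_range] at this
    exact_mod_cast (by omega : 2 * #((Finset.range (2 * ℓ)).filter fun m => 2 ≤ m ∧ m < n) ≤ 4 * ℓ)
  have hE := energy_nonneg f
  calc _ ≤ 4 * (ℓ : ℝ) * (1200 * n ^ 2 * (n + 4 * ℓ ^ 2) * energy f) :=
        mul_le_mul_of_nonneg_right h3 (by positivity)
    _ = _ := by ring

end Coordinates

section Poincare

theorem sum_comp_le_card_mul {X Y : Type*} [DecidableEq Y] {A : Finset X} {B : Finset Y}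
    (g : X → Y) (φ : Y → ℝ) (D : ℝ) (hg : ∀ x ∈ A, g x ∈ B) (hφ : ∀ y, 0 ≤ φ y)
    (hD : ∀ y ∈ B, (#(A.filter fun x => g x = y) : ℝ) ≤ D) :
    ∑ x ∈ A, φ (g x) ≤ D * ∑ y ∈ B, φ y := by
  rw [← Finset.sum_fiberwise_of_maps_to hg, Finset.mul_sum]
  refine Finset.sum_le_sum fun y hy => ?_
  rw [Finset.sum_congr rfl fun x hx => by rw [(Finset.mem_filter.1 hx).2], Finset.sum_const,
    nsmul_eq_mul]
  exact mul_le_mul_of_nonneg_right (hD y hy) (hφ y)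

variable {n : ℕ} {ι : Type} [DecidableEq ι] [NeZero n] [Fintype ι]
variable {B : Type} [DecidableEq B] (blk : ZMod n → B)

/-- The coordinates of the corners of a rectangle. -/
def corners (h h' : Board n) : Finset (ZMod n) := {h.1, h.2, h'.1, h'.2}

theorem corners_comm (h h' : Board n) : corners h h' = corners h' h := by
  ext v; simp [corners]; tauto

open Classical in
/-- Pairs of placements in the same block, whose coordinates outside of `s` agree and do not
interfere with the motion of the hole. -/
noncomputable def linked (s : Finset (ι × Bool)) :
    Finset ((Option ι → Board n) × (Option ι → Board n)) :=
  (placements n ι ×ˢ placements n ι).filter fun q =>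
    (∀ c, blk (coord q.1 c) = blk (coord q.2 c)) ∧
      ∀ c ∉ s, coord q.1 c = coord q.2 c ∧ coord q.1 c ∉ corners (q.1 none) (q.2 none)

variable {blk}

theorem mem_linked {s : Finset (ι × Bool)} {q : (Option ι → Board n) × (Option ι → Board n)} :
    q ∈ linked blk s ↔ (q.1 ∈ placements n ι ∧ q.2 ∈ placements n ι) ∧
      (∀ c, blk (coord q.1 c) = blk (coord q.2 c)) ∧
      ∀ c ∉ s, coord q.1 c = coord q.2 c ∧ coord q.1 c ∉ corners (q.1 none) (q.2 none) := by
  classical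
  rw [linked, Finset.mem_filter, Finset.mem_product]

theorem swap_mem_linked {s : Finset (ι × Bool)} {q : (Option ι → Board n) × (Option ι → Board n)}
    (hq : q ∈ linked blk s) : q.swap ∈ linked blk s := by
  rw [mem_linked] at hq ⊢
  refine ⟨hq.1.symm, fun c => (hq.2.1 c).symm, fun c hc => ?_⟩
  obtain ⟨h1, h2⟩ := hq.2.2 c hc
  refine ⟨h1.symm, ?_⟩
  rw [Prod.fst_swap, Prod.snd_swap, ← h1, corners_comm]
  exact h2

theorem eq_path_of_mem_linked {q : (Option ι → Board n) × (Option ι → Board n)}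
    (hq : q ∈ linked blk ∅) :
    q.2 = (slide none (0, 1))^[((q.2 none).2 - (q.1 none).2).val]
      ((slide none (1, 0))^[((q.2 none).1 - (q.1 none).1).val] q.1) := by
  obtain ⟨x, y⟩ := q
  obtain ⟨-, -, h⟩ := mem_linked.1 hq
  simp only [Finset.notMem_empty, not_false_eq_true, true_implies, corners, Finset.mem_insert,
    Finset.mem_singleton, not_or] at h ⊢
  have e1 : ∀ i, (slide none (1, 0))^[((y none).1 - (x none).1).val] x (some i) = x (some i) := by
    intro i
    refine slide_iterate_of_ne _ fun j _ hj => (h (i, true)).2.2.1 ?_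
    rw [coord, cond_true, hj]
    simp
  funext l
  cases l with
  | none =>
    rw [slide_iterate_hole, slide_iterate_hole]
    ext <;> simp
  | some i =>
    rw [slide_iterate_of_ne, e1]
    · exact Prod.ext (h (i, false)).1.symm (h (i, true)).1.symm
    · intro j _ hj
      rw [e1, slide_iterate_hole] at hj
      refine (h (i, false)).2.2.2.1 ?_
      rw [coord, cond_false, hj]
      simp

/-- The sum of the squared differences of `f` over linked pairs. -/
noncomputable def spread (blk : ZMod n → B) (f : (Option ι → Board n) → ℝ)
    (s : Finset (ι × Bool)) : ℝ :=
  ∑ q ∈ linked blk s, (f q.1 - f q.2) ^ 2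

theorem spread_empty_le (f : (Option ι → Board n) → ℝ) :
    spread blk f ∅ ≤ 4 * n ^ 5 * energy f := by
  classical
  rw [spread, ← Finset.sum_fiberwise_of_maps_to (s := linked blk ∅)
    (t := (Finset.univ : Finset (Board n × Board n))) (g := fun q => (q.1 none, q.2 none))
    fun _ _ => Finset.mem_univ _]
  have hb : ∀ w ∈ (Finset.univ : Finset (Board n × Board n)),
      ∑ q ∈ (linked blk ∅).filter (fun q => (q.1 none, q.2 none) = w), (f q.1 - f q.2) ^ 2 ≤
        4 * n * energy f := by
    rintro ⟨h, h'⟩ _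
    set g1 := (slide (n := n) (none : Option ι) (1, 0))^[(h'.1 - h.1).val] with hg1
    set g2 := (slide (n := n) (none : Option ι) (0, 1))^[(h'.2 - h.2).val] with hg2
    set A := (placements n ι).filter fun x => x none = h with hA
    have hq : ∀ q ∈ (linked blk ∅).filter (fun q => (q.1 none, q.2 none) = (h, h')),
        q.2 = g2 (g1 q.1) := by
      intro q hq
      obtain ⟨hq, e⟩ := Finset.mem_filter.1 hq
      rw [Prod.mk.injEq] at e
      rw [hg1, hg2, ← e.1, ← e.2]
      exact eq_path_of_mem_linked hq
    have i1 : Function.Injective g1 := (slide_injective _ _).iterate _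
    have t0 := sum_le_sum_of_injOn (B := A)
      (A := (linked blk ∅).filter (fun q => (q.1 none, q.2 none) = (h, h'))) Prod.fst
      (fun x => (f x - f (g2 (g1 x))) ^ 2) (by
        intro q hq
        obtain ⟨hq, e⟩ := Finset.mem_filter.1 hq
        rw [Prod.mk.injEq] at e
        exact Finset.mem_filter.2 ⟨(mem_linked.1 hq).1.1, e.1⟩) (by
        intro q h1 q' h2 e
        exact Prod.ext e (by rw [hq q h1, hq q' h2, e])) fun _ => sq_nonneg _
    have hAp : A ⊆ placements n ι := Finset.filter_subset _ _
    have t1 := sum_sq_line_le f right_mem_displacements hAp (h'.1 - h.1).val h (fun x => x none)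
      (fun j _ x hx => by rw [slide_iterate_hole, (Finset.mem_filter.1 hx).2])
      (fun i hi j hj e => nsmul_unit_injective (hi.trans (ZMod.val_lt _))
        (hj.trans (ZMod.val_lt _)) (by simp) e)
    have t2 := sum_sq_line_le f up_mem_displacements (A := A.image g1)
      (Finset.image_subset_iff.2 fun x hx => slide_iterate_mem_placements _ (hAp hx))
      (h'.2 - h.2).val (h + (h'.1 - h.1).val • ((1, 0) : Board n)) (fun x => x none)
      (fun j _ y hy => by
        obtain ⟨x, hx, rfl⟩ := Finset.mem_image.1 hy
        rw [slide_iterate_hole, hg1, slide_iterate_hole, (Finset.mem_filter.1 hx).2])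
      (fun i hi j hj e => nsmul_unit_injective (hi.trans (ZMod.val_lt _))
        (hj.trans (ZMod.val_lt _)) (by simp) e)
    rw [Finset.sum_image i1.injOn] at t2
    have t3 : ∑ x ∈ A, (f x - f (g2 (g1 x))) ^ 2 ≤
        2 * (∑ x ∈ A, (f (g1 x) - f x) ^ 2 + ∑ x ∈ A, (f (g2 (g1 x)) - f (g1 x)) ^ 2) := by
      rw [← Finset.sum_add_distrib, Finset.mul_sum]
      refine Finset.sum_le_sum fun x _ => ?_
      nlinarith [sq_nonneg ((f (g1 x) - f x) - (f (g2 (g1 x)) - f (g1 x)))]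
    have hE := energy_nonneg f
    have b (w : ZMod n) : (w.val : ℝ) * energy f ≤ n * energy f :=
      mul_le_mul_of_nonneg_right (by exact_mod_cast (ZMod.val_lt w).le) hE
    have b1 := t1.trans (b _)
    have b2 := t2.trans (b _)
    have t4 : ∑ q ∈ (linked blk ∅).filter (fun q => (q.1 none, q.2 none) = (h, h')),
        (f q.1 - f q.2) ^ 2 = ∑ q ∈ (linked blk ∅).filter
          (fun q => (q.1 none, q.2 none) = (h, h')), (f q.1 - f (g2 (g1 q.1))) ^ 2 :=
      Finset.sum_congr rfl fun q h1 => by rw [← hq q h1]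
    rw [t4]
    linarith
  refine (Finset.sum_le_sum hb).trans (le_of_eq ?_)
  rw [Finset.sum_const, Finset.card_univ, Fintype.card_prod, Fintype.card_prod, ZMod.card,
    nsmul_eq_mul]
  push_cast
  ring

theorem card_block_le {ℓ : ℕ} (hclose : ∀ v w, blk v = blk w → v.val < w.val + 2 * ℓ) (b : B) :
    #(Finset.univ.filter fun v => blk v = b) ≤ 2 * ℓ := by
  rcases (Finset.univ.filter fun v => blk v = b).eq_empty_or_nonempty with h | h
  · rw [h]; simp
  obtain ⟨w, hw, hmin⟩ := Finset.exists_min_image _ ZMod.val h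
  have hw' := (Finset.mem_filter.1 hw).2
  have : #(Finset.univ.filter fun v => blk v = b) ≤ #(Finset.Ico w.val (w.val + 2 * ℓ)) := by
    refine Finset.card_le_card_of_injOn ZMod.val ?_ (ZMod.val_injective n).injOn
    intro v hv
    have hv' := (Finset.mem_filter.1 hv).2
    exact Finset.mem_coe.2 (Finset.mem_Ico.2 ⟨hmin v hv, hclose _ _ (hv'.trans hw'.symm)⟩)
  simpa using this

theorem card_linked_fst_le {ℓ : ℕ} (hclose : ∀ v w, blk v = blk w → v.val < w.val + 2 * ℓ)
    (s : Finset (ι × Bool)) (x : Option ι → Board n)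
    [DecidablePred fun q : (Option ι → Board n) × (Option ι → Board n) => q.1 = x] :
    #((linked blk s).filter fun q => q.1 = x) ≤ n ^ 2 * (2 * ℓ) ^ #s := by
  classical
  set T := (Finset.univ : Finset (Board n)) ×ˢ
    Fintype.piFinset fun c : s => Finset.univ.filter fun v => blk v = blk (coord x c) with hT
  have hTc : #T ≤ n ^ 2 * (2 * ℓ) ^ #s := by
    rw [hT, Finset.card_product, Finset.card_univ, Fintype.card_prod, ZMod.card,
      Fintype.card_piFinset, ← sq]
    refine Nat.mul_le_mul_left _ ?_
    refine (Finset.prod_le_prod' fun (c : s) _ => card_block_le hclose (blk (coord x c.1))).trans ?_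
    simp
  refine (Finset.card_le_card_of_injOn (fun q => (q.2 none, fun c : s => coord q.2 c)) ?_
    ?_).trans hTc
  · intro q hq
    obtain ⟨hq', rfl⟩ := Finset.mem_filter.1 hq
    have hb := (mem_linked.1 hq').2.1
    rw [Finset.mem_coe, hT, Finset.mem_product, Fintype.mem_piFinset]
    refine ⟨Finset.mem_univ _, fun c => ?_⟩
    rw [Finset.mem_filter]
    exact ⟨Finset.mem_univ _, (hb c.1).symm⟩
  · intro q hq q' hq' e
    obtain ⟨hq, h1⟩ := Finset.mem_filter.1 hq
    obtain ⟨hq', h2⟩ := Finset.mem_filter.1 hq'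
    rw [Prod.mk.injEq] at e
    refine Prod.ext (h1.trans h2.symm) (placement_ext e.1 fun c => ?_)
    by_cases hc : c ∈ s
    · exact congrFun e.2 ⟨c, hc⟩
    · rw [← ((mem_linked.1 hq).2.2 c hc).1, ← ((mem_linked.1 hq').2.2 c hc).1, h1, h2]

theorem card_linked_snd_le {ℓ : ℕ} (hclose : ∀ v w, blk v = blk w → v.val < w.val + 2 * ℓ)
    (s : Finset (ι × Bool)) (x : Option ι → Board n)
    [DecidablePred fun q : (Option ι → Board n) × (Option ι → Board n) => q.2 = x] :
    #((linked blk s).filter fun q => q.2 = x) ≤ n ^ 2 * (2 * ℓ) ^ #s := by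
  classical
  refine le_trans (Finset.card_le_card_of_injOn Prod.swap ?_ Prod.swap_injective.injOn)
    (card_linked_fst_le hclose s x)
  intro q hq
  obtain ⟨hq, e⟩ := Finset.mem_filter.1 hq
  exact Finset.mem_coe.2 (Finset.mem_filter.2 ⟨swap_mem_linked hq, e⟩)

end Poincare

section PoincareInequality

variable {n : ℕ} {ι : Type} [DecidableEq ι] [NeZero n] [Fintype ι]
variable {B : Type} [DecidableEq B] {blk : ZMod n → B}

/-- Values to which a coordinate of both placements of a pair can be moved. -/
noncomputable def meeting (blk : ZMod n → B) (c : ι × Bool)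
    (q : (Option ι → Board n) × (Option ι → Board n)) : Finset (ZMod n) :=
  (reachable q.1 c blk ∩ reachable q.2 c blk) \ corners (q.1 none) (q.2 none)

theorem le_card_meeting {ℓ : ℕ} (hlarge : ∀ v, ℓ ≤ #(Finset.univ.filter fun w => blk w = blk v))
    (hℓ : 16 * Fintype.card ι + 40 ≤ ℓ) {c : ι × Bool}
    {q : (Option ι → Board n) × (Option ι → Board n)} (hq : blk (coord q.1 c) = blk (coord q.2 c)) :
    ℓ ≤ 2 * #(meeting blk c q) := by
  set S := Finset.univ.filter fun v => blk v = blk (coord q.1 c) with hS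
  have h1 : #(S \ reachable q.1 c blk) ≤ 4 * Fintype.card ι + 8 :=
      card_block_sdiff_reachable_le q.1 c
  have h2 : #(S \ reachable q.2 c blk) ≤ 4 * Fintype.card ι + 8 := by
    rw [hS, hq]
    exact card_block_sdiff_reachable_le q.2 c
  have h3 : #(corners (q.1 none) (q.2 none)) ≤ 4 := Finset.card_le_four
  have hsub : S ⊆ meeting blk c q ∪ ((S \ reachable q.1 c blk) ∪ ((S \ reachable q.2 c blk) ∪
      corners (q.1 none) (q.2 none))) := by
    intro v hv
    simp only [meeting, Finset.mem_union, Finset.mem_sdiff, Finset.mem_inter]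
    tauto
  have h4 := Finset.card_le_card hsub
  have h5 := Finset.card_union_le (meeting blk c q) ((S \ reachable q.1 c blk) ∪
    ((S \ reachable q.2 c blk) ∪ corners (q.1 none) (q.2 none)))
  have h6 := Finset.card_union_le (S \ reachable q.1 c blk)
    ((S \ reachable q.2 c blk) ∪ corners (q.1 none) (q.2 none))
  have h7 := Finset.card_union_le (S \ reachable q.2 c blk) (corners (q.1 none) (q.2 none))
  have h8 : ℓ ≤ #S := hlarge _
  omega

theorem setCoord_pair_mem_linked {s : Finset (ι × Bool)} {c : ι × Bool}
    {q : (Option ι → Board n) × (Option ι → Board n)} (hq : q ∈ linked blk (insert c s))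
    {w : ZMod n} (hw : w ∈ meeting blk c q) :
    (setCoord q.1 c w, setCoord q.2 c w) ∈ linked blk s := by
  obtain ⟨⟨h1, h2⟩, h3, h4⟩ := mem_linked.1 hq
  simp only [meeting, Finset.mem_sdiff, Finset.mem_inter] at hw
  refine mem_linked.2 ⟨⟨setCoord_mem_placements h1 hw.1.1, setCoord_mem_placements h2 hw.1.2⟩,
    fun c' => ?_, fun c' hc' => ?_⟩
  · by_cases h : c' = c
    · subst h; simp
    · simpa [coord_setCoord_of_ne _ _ h] using h3 c'
  · by_cases h : c' = c
    · subst h; simpa using hw.2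
    · simpa [coord_setCoord_of_ne _ _ h] using h4 c' (by simp [h, hc'])

theorem sum_meeting_fst_le (hn : 4 ≤ n) (f : (Option ι → Board n) → ℝ) {ℓ : ℕ}
    (hclose : ∀ v w, blk v = blk w → v.val < w.val + 2 * ℓ) (c : ι × Bool) (s : Finset (ι × Bool)) :
    ∑ q ∈ linked blk s, ∑ w ∈ meeting blk c q, (f (setCoord q.1 c w) - f q.1) ^ 2 ≤
      n ^ 2 * (2 * ℓ) ^ #s * (4800 * ℓ * n ^ 2 * (n + 4 * ℓ ^ 2) * energy f) := by
  classical
  calc _ ≤ ∑ q ∈ linked blk s, ∑ w ∈ reachable q.1 c blk, (f (setCoord q.1 c w) - f q.1) ^ 2 :=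
        Finset.sum_le_sum fun q _ => Finset.sum_le_sum_of_subset_of_nonneg
          (Finset.sdiff_subset.trans Finset.inter_subset_left) fun _ _ _ => sq_nonneg _
    _ ≤ n ^ 2 * (2 * ℓ) ^ #s * ∑ x ∈ placements n ι, ∑ w ∈ reachable x c blk,
          (f (setCoord x c w) - f x) ^ 2 := by
        refine sum_comp_le_card_mul Prod.fst (fun x => ∑ w ∈ reachable x c blk,
          (f (setCoord x c w) - f x) ^ 2) _ (fun q hq => (mem_linked.1 hq).1.1)
          (fun _ => Finset.sum_nonneg fun _ _ => sq_nonneg _) fun x _ => ?_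
        exact_mod_cast card_linked_fst_le hclose s x
    _ ≤ _ := mul_le_mul_of_nonneg_left (sum_sq_setCoord_le hn f hclose c) (by positivity)

theorem sum_meeting_snd_le (hn : 4 ≤ n) (f : (Option ι → Board n) → ℝ) {ℓ : ℕ}
    (hclose : ∀ v w, blk v = blk w → v.val < w.val + 2 * ℓ) (c : ι × Bool) (s : Finset (ι × Bool)) :
    ∑ q ∈ linked blk s, ∑ w ∈ meeting blk c q, (f (setCoord q.2 c w) - f q.2) ^ 2 ≤
      n ^ 2 * (2 * ℓ) ^ #s * (4800 * ℓ * n ^ 2 * (n + 4 * ℓ ^ 2) * energy f) := by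
  classical
  calc _ ≤ ∑ q ∈ linked blk s, ∑ w ∈ reachable q.2 c blk, (f (setCoord q.2 c w) - f q.2) ^ 2 :=
        Finset.sum_le_sum fun q _ => Finset.sum_le_sum_of_subset_of_nonneg
          (Finset.sdiff_subset.trans Finset.inter_subset_right) fun _ _ _ => sq_nonneg _
    _ ≤ n ^ 2 * (2 * ℓ) ^ #s * ∑ x ∈ placements n ι, ∑ w ∈ reachable x c blk,
          (f (setCoord x c w) - f x) ^ 2 := by
        refine sum_comp_le_card_mul Prod.snd (fun x => ∑ w ∈ reachable x c blk,
          (f (setCoord x c w) - f x) ^ 2) _ (fun q hq => (mem_linked.1 hq).1.2)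
          (fun _ => Finset.sum_nonneg fun _ _ => sq_nonneg _) fun x _ => ?_
        exact_mod_cast card_linked_snd_le hclose s x
    _ ≤ _ := mul_le_mul_of_nonneg_left (sum_sq_setCoord_le hn f hclose c) (by positivity)

theorem sum_meeting_middle_le (f : (Option ι → Board n) → ℝ) {ℓ : ℕ}
    (hclose : ∀ v w, blk v = blk w → v.val < w.val + 2 * ℓ) (c : ι × Bool) (s : Finset (ι × Bool)) :
    ∑ q ∈ linked blk (insert c s), ∑ w ∈ meeting blk c q,
      (f (setCoord q.1 c w) - f (setCoord q.2 c w)) ^ 2 ≤ (2 * ℓ) ^ 2 * spread blk f s := by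
  classical
  rw [Finset.sum_sigma', spread]
  refine sum_comp_le_card_mul
    (fun a : Σ _ : (Option ι → Board n) × (Option ι → Board n), ZMod n =>
      (setCoord a.1.1 c a.2, setCoord a.1.2 c a.2)) (fun q => (f q.1 - f q.2) ^ 2) _ ?_
    (fun _ => sq_nonneg _) ?_
  · rintro ⟨q, w⟩ h
    exact setCoord_pair_mem_linked (Finset.mem_sigma.1 h).1 (Finset.mem_sigma.1 h).2
  rintro ⟨y, y'⟩ _
  set b := blk (coord y c) with hb
  have hcard : #((Finset.univ.filter fun v => blk v = b) ×ˢ Finset.univ.filter fun v => blk v = b)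
      ≤ (2 * ℓ) ^ 2 := by
    rw [Finset.card_product, ← sq]
    exact Nat.pow_le_pow_left (card_block_le hclose b) 2
  have h : #(((linked blk (insert c s)).sigma fun q => meeting blk c q).filter fun a =>
      (setCoord a.1.1 c a.2, setCoord a.1.2 c a.2) = (y, y')) ≤ (2 * ℓ) ^ 2 := by
    refine le_trans (Finset.card_le_card_of_injOn
      (fun a => (coord a.1.1 c, coord a.1.2 c)) ?_ ?_) hcard
    · rintro ⟨⟨x, x'⟩, w⟩ ha
      obtain ⟨ha, e⟩ := Finset.mem_filter.1 ha
      obtain ⟨hq, hw⟩ := Finset.mem_sigma.1 ha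
      have hq2 := (mem_linked.1 hq).2.1 c
      simp only [meeting, Finset.mem_sdiff, Finset.mem_inter] at hw
      simp only [Prod.mk.injEq] at e hq2
      have hwb : b = blk w := by rw [hb, ← e.1, coord_setCoord_self]
      have h1 := blk_of_mem_reachable hw.1.1
      simp only [Finset.coe_product, Finset.coe_filter, Finset.mem_univ, true_and, Set.mem_prod,
        Set.mem_ofPred_eq]
      exact ⟨by rw [hwb, h1], by rw [hwb, h1, hq2]⟩
    · rintro ⟨⟨x, x'⟩, w⟩ ha ⟨⟨z, z'⟩, u⟩ ha' e
      have e1 := (Finset.mem_filter.1 ha).2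
      have e2 := (Finset.mem_filter.1 ha').2
      simp only [Prod.mk.injEq] at e e1 e2
      have hx : x = setCoord y c (coord x c) := by rw [← e1.1]; simp
      have hx' : x' = setCoord y' c (coord x' c) := by rw [← e1.2]; simp
      have hz : z = setCoord y c (coord z c) := by rw [← e2.1]; simp
      have hz' : z' = setCoord y' c (coord z' c) := by rw [← e2.2]; simp
      have hw : w = coord y c := by rw [← e1.1]; simp
      have hu : u = coord y c := by rw [← e2.1]; simp
      rw [e.1, ← hz] at hx
      rw [e.2, ← hz'] at hx'
      rw [hx, hx', hw, hu]
  exact_mod_cast h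

theorem spread_insert_le (hn : 4 ≤ n) (f : (Option ι → Board n) → ℝ) {ℓ : ℕ}
    (hclose : ∀ v w, blk v = blk w → v.val < w.val + 2 * ℓ)
    (hlarge : ∀ v, ℓ ≤ #(Finset.univ.filter fun w => blk w = blk v))
    (hℓ : 16 * Fintype.card ι + 40 ≤ ℓ) {c : ι × Bool} {s : Finset (ι × Bool)} (hc : c ∉ s) :
    spread blk f (insert c s) ≤
      12 * n ^ 2 * (2 * ℓ) ^ (#s + 1) * (4800 * n ^ 2 * (n + 4 * ℓ ^ 2) * energy f) +
        24 * ℓ * spread blk f s := by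
  have hl0 : (0 : ℝ) < ℓ := by exact_mod_cast (by omega : 0 < ℓ)
  have h1 := sum_meeting_fst_le hn f hclose c (insert c s)
  have h2 := sum_meeting_snd_le hn f hclose c (insert c s)
  have h3 := sum_meeting_middle_le f hclose c s
  rw [Finset.card_insert_of_notMem hc] at h1 h2
  have h4 : (ℓ : ℝ) * spread blk f (insert c s) ≤ 6 * (
      ∑ q ∈ linked blk (insert c s), ∑ w ∈ meeting blk c q, (f (setCoord q.1 c w) - f q.1) ^ 2 +
      ∑ q ∈ linked blk (insert c s), ∑ w ∈ meeting blk c q,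
        (f (setCoord q.1 c w) - f (setCoord q.2 c w)) ^ 2 +
      ∑ q ∈ linked blk (insert c s), ∑ w ∈ meeting blk c q,
        (f (setCoord q.2 c w) - f q.2) ^ 2) := by
    rw [spread, Finset.mul_sum, ← Finset.sum_add_distrib, ← Finset.sum_add_distrib,
      Finset.mul_sum]
    refine Finset.sum_le_sum fun q hq => ?_
    rw [← Finset.sum_add_distrib, ← Finset.sum_add_distrib, Finset.mul_sum]
    have hm : (ℓ : ℝ) ≤ 2 * #(meeting blk c q) := by
      exact_mod_cast le_card_meeting hlarge hℓ ((mem_linked.1 hq).2.1 c)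
    calc (ℓ : ℝ) * (f q.1 - f q.2) ^ 2 ≤ 2 * #(meeting blk c q) * (f q.1 - f q.2) ^ 2 :=
          mul_le_mul_of_nonneg_right hm (sq_nonneg _)
      _ = ∑ w ∈ meeting blk c q, 2 * (f q.1 - f q.2) ^ 2 := by
          rw [Finset.sum_const, nsmul_eq_mul]; ring
      _ ≤ _ := by
          refine Finset.sum_le_sum fun w _ => ?_
          have := sq_sub_le_three (f q.1) (f (setCoord q.1 c w)) (f (setCoord q.2 c w)) (f q.2)
          nlinarith [this]
  refine le_of_mul_le_mul_left (h4.trans ?_) hl0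
  set W := 4800 * (n : ℝ) ^ 2 * (n + 4 * ℓ ^ 2) * energy f with hW
  have e : (4800 : ℝ) * ℓ * n ^ 2 * (n + 4 * ℓ ^ 2) * energy f = ℓ * W := by rw [hW]; ring
  rw [e] at h1 h2
  calc _ ≤ 6 * (n ^ 2 * (2 * ℓ) ^ (#s + 1) * (ℓ * W) + (2 * ℓ) ^ 2 * spread blk f s +
        n ^ 2 * (2 * ℓ) ^ (#s + 1) * (ℓ * W)) := by gcongr
    _ = _ := by ring

theorem spread_le (hn : 4 ≤ n) (f : (Option ι → Board n) → ℝ) {ℓ : ℕ}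
    (hclose : ∀ v w, blk v = blk w → v.val < w.val + 2 * ℓ)
    (hlarge : ∀ v, ℓ ≤ #(Finset.univ.filter fun w => blk w = blk v))
    (hℓ : 16 * Fintype.card ι + 40 ≤ ℓ) (s : Finset (ι × Bool)) :
    spread blk f s ≤
      (100 * ℓ) ^ #s * (n ^ 2 * (4800 * n ^ 2 * (n + 4 * ℓ ^ 2) * energy f)) := by
  have hl0 : (0 : ℝ) < ℓ := by exact_mod_cast (by omega : 0 < ℓ)
  have hE := energy_nonneg f
  have hn1 : (1 : ℝ) ≤ n := by exact_mod_cast (by omega : 1 ≤ n)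
  induction s using Finset.induction_on with
  | empty =>
    refine (spread_empty_le f).trans ?_
    rw [Finset.card_empty, pow_zero, one_mul]
    have : (n : ℝ) ^ 2 * (4800 * n ^ 2 * (n + 4 * ℓ ^ 2) * energy f) =
        4800 * n ^ 5 * energy f + 19200 * n ^ 4 * ℓ ^ 2 * energy f := by ring
    rw [this]
    have h1 : 0 ≤ (n : ℝ) ^ 5 * energy f := by positivity
    have h2 : 0 ≤ 19200 * (n : ℝ) ^ 4 * ℓ ^ 2 * energy f := by positivity
    linarith
  | insert c s hc ih =>
    refine (spread_insert_le hn f hclose hlarge hℓ hc).trans ?_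
    rw [Finset.card_insert_of_notMem hc]
    set W := 4800 * (n : ℝ) ^ 2 * (n + 4 * ℓ ^ 2) * energy f with hW
    have hW0 : 0 ≤ W := by positivity
    have h1 : (2 * (ℓ : ℝ)) ^ #s ≤ (100 * ℓ) ^ #s := by gcongr; norm_num
    have h2 : 0 ≤ (100 * (ℓ : ℝ)) ^ #s * (n ^ 2 * W) * ℓ := by positivity
    calc _ ≤ 12 * n ^ 2 * ((100 * ℓ) ^ #s * (2 * ℓ)) * W +
          24 * ℓ * ((100 * ℓ) ^ #s * (n ^ 2 * W)) := by
          have e : (2 * (ℓ : ℝ)) ^ (#s + 1) = (2 * ℓ) ^ #s * (2 * ℓ) := pow_succ _ _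
          rw [e]; gcongr
      _ = 48 * ((100 * (ℓ : ℝ)) ^ #s * (n ^ 2 * W) * ℓ) := by ring
      _ ≤ 100 * ((100 * (ℓ : ℝ)) ^ #s * (n ^ 2 * W) * ℓ) := by linarith
      _ = _ := by ring

end PoincareInequality

section BlockAverages

variable {n : ℕ} {ι : Type} [DecidableEq ι] [NeZero n] [Fintype ι]
variable {B : Type} [DecidableEq B] (blk : ZMod n → B)

open Classical in
/-- The placements in the same block as `x` that agree with `x` in the coordinates outside `s`. -/
noncomputable def cell (s : Finset (ι × Bool)) (x : Option ι → Board n) :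
    Finset (Option ι → Board n) :=
  (placements n ι).filter fun y => (∀ c, blk (coord y c) = blk (coord x c)) ∧
    ∀ c ∉ s, coord y c = coord x c

variable {blk}

theorem mem_cell {s : Finset (ι × Bool)} {x y : Option ι → Board n} :
    y ∈ cell blk s x ↔ y ∈ placements n ι ∧ (∀ c, blk (coord y c) = blk (coord x c)) ∧
      ∀ c ∉ s, coord y c = coord x c := by
  classical
  rw [cell, Finset.mem_filter]

theorem le_card_cell_empty (h2 : 2 * Fintype.card ι ≤ n) {x : Option ι → Board n}
    (hx : x ∈ placements n ι) : n ^ 2 ≤ 2 * #(cell blk ∅ x) := by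
  classical
  set T : Finset (Board n) := Finset.univ \ Finset.univ.image fun i => x (some i) with hT
  have hTc : n ^ 2 ≤ #T + Fintype.card ι := by
    have h3 := Finset.card_image_le (s := (Finset.univ : Finset ι)) (f := fun i => x (some i))
    have h4 : #(Finset.univ : Finset (Board n)) - #(Finset.univ.image fun i => x (some i)) ≤ #T :=
      Finset.le_card_sdiff _ _
    rw [Finset.card_univ, Fintype.card_prod, ZMod.card, ← sq] at h4
    rw [Finset.card_univ] at h3
    omega
  have hle : #T ≤ #(cell blk ∅ x) := by
    refine Finset.card_le_card_of_injOn (fun h => Function.update x none h) ?_ ?_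
    · intro h hh
      have hh' : ∀ i, x (some i) ≠ h := fun i hi => by
        refine (Finset.mem_sdiff.1 hh).2 (Finset.mem_image.2 ⟨i, Finset.mem_univ _, hi⟩)
      refine mem_cell.2 ⟨?_, fun c => by simp [coord], fun c _ => by simp [coord]⟩
      rw [mem_placements] at hx ⊢
      refine hx.update_of_notMem _ fun l hl e => ?_
      cases l with
      | none => exact hl rfl
      | some i => exact hh' i e
    · intro h _ h' _ e
      simpa using congrFun e none
  have : n ≤ n ^ 2 := Nat.le_self_pow (by norm_num) n
  omega

theorem mul_card_cell_le {ℓ : ℕ} (hlarge : ∀ v, ℓ ≤ #(Finset.univ.filter fun w => blk w = blk v))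
    (hℓ : 16 * Fintype.card ι + 40 ≤ ℓ) {c : ι × Bool} {s : Finset (ι × Bool)} (hc : c ∉ s)
    (x : Option ι → Board n) : ℓ * #(cell blk s x) ≤ 2 * #(cell blk (insert c s) x) := by
  classical
  have hr : ∀ y, ℓ ≤ 2 * #(reachable y c blk) := fun y => by
    have h1 := card_block_sdiff_reachable_le (blk := blk) y c
    have h2 := hlarge (coord y c)
    have h3 := Finset.le_card_sdiff (reachable y c blk)
      (Finset.univ.filter fun v => blk v = blk (coord y c))
    omega
  have h1 : #((cell blk s x).sigma fun y => reachable y c blk) ≤ #(cell blk (insert c s) x) := by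
    refine Finset.card_le_card_of_injOn (fun a => setCoord a.1 c a.2) ?_ ?_
    · rintro ⟨y, w⟩ h
      obtain ⟨hy, hw⟩ := Finset.mem_sigma.1 h
      obtain ⟨hy1, hy2, hy3⟩ := mem_cell.1 hy
      refine mem_cell.2 ⟨setCoord_mem_placements hy1 hw, fun c' => ?_, fun c' hc' => ?_⟩
      · by_cases h : c' = c
        · subst h
          simpa using (blk_of_mem_reachable hw).trans (hy2 c')
        · simpa [coord_setCoord_of_ne _ _ h] using hy2 c'
      · rw [Finset.mem_insert, not_or] at hc'
        simpa [coord_setCoord_of_ne _ _ hc'.1] using hy3 c' hc'.2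
    · rintro ⟨y, w⟩ h ⟨z, u⟩ h' e
      have hy := (mem_cell.1 (Finset.mem_sigma.1 h).1).2.2 c hc
      have hz := (mem_cell.1 (Finset.mem_sigma.1 h').1).2.2 c hc
      simp only at e hy hz
      have h1 : w = u := by simpa using congrArg (fun y => coord y c) e
      have h2 : y = z := by
        rw [← setCoord_coord y c, ← setCoord_coord z c, hy, hz]
        simpa using congrArg (fun y => setCoord y c (coord x c)) e
      rw [h1, h2]
  rw [Finset.card_sigma] at h1
  calc ℓ * #(cell blk s x) = ∑ _y ∈ cell blk s x, ℓ := by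
        rw [Finset.sum_const, smul_eq_mul, mul_comm]
    _ ≤ ∑ y ∈ cell blk s x, 2 * #(reachable y c blk) := Finset.sum_le_sum fun y _ => hr y
    _ ≤ _ := by rw [← Finset.mul_sum]; omega

theorem le_card_cell {ℓ : ℕ} (hlarge : ∀ v, ℓ ≤ #(Finset.univ.filter fun w => blk w = blk v))
    (hℓ : 16 * Fintype.card ι + 40 ≤ ℓ) {x : Option ι → Board n} (hx : x ∈ placements n ι)
    (s : Finset (ι × Bool)) : n ^ 2 * ℓ ^ #s ≤ 2 * 2 ^ #s * #(cell blk s x) := by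
  induction s using Finset.induction_on with
  | empty =>
    have h1 := (hlarge 0).trans (Finset.card_le_univ _)
    rw [ZMod.card] at h1
    simpa using le_card_cell_empty (blk := blk) (by omega) hx
  | insert c s hc ih =>
    rw [Finset.card_insert_of_notMem hc]
    calc n ^ 2 * ℓ ^ (#s + 1) = n ^ 2 * ℓ ^ #s * ℓ := by ring
      _ ≤ 2 * 2 ^ #s * #(cell blk s x) * ℓ := Nat.mul_le_mul_right _ ih
      _ = 2 * 2 ^ #s * (ℓ * #(cell blk s x)) := by ring
      _ ≤ 2 * 2 ^ #s * (2 * #(cell blk (insert c s) x)) :=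
        Nat.mul_le_mul_left _ (mul_card_cell_le hlarge hℓ hc x)
      _ = _ := by ring

theorem sum_cell_sq_le_spread (f : (Option ι → Board n) → ℝ)
    (hf : ∀ x ∈ placements n ι, ∑ y ∈ cell blk Finset.univ x, f y = 0) :
    ∑ x ∈ placements n ι, #(cell blk Finset.univ x) * f x ^ 2 ≤ spread blk f Finset.univ := by
  classical
  have h : spread blk f Finset.univ =
      ∑ x ∈ placements n ι, ∑ y ∈ cell blk Finset.univ x, (f x - f y) ^ 2 := by
    rw [spread, linked, Finset.sum_filter, Finset.sum_product]
    refine Finset.sum_congr rfl fun x _ => ?_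
    rw [cell, Finset.sum_filter]
    refine Finset.sum_congr rfl fun y _ => ?_
    simp only [Finset.mem_univ, not_true_eq_false, false_imp_iff, implies_true, and_true,
      eq_comm (a := blk (coord x _))]
  rw [h]
  refine Finset.sum_le_sum fun x hx => ?_
  have h1 : ∑ y ∈ cell blk Finset.univ x, (f x - f y) ^ 2 = #(cell blk Finset.univ x) * f x ^ 2 -
      2 * f x * ∑ y ∈ cell blk Finset.univ x, f y + ∑ y ∈ cell blk Finset.univ x, f y ^ 2 := by
    rw [Finset.mul_sum, ← nsmul_eq_mul, ← Finset.sum_const, ← Finset.sum_sub_distrib,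
      ← Finset.sum_add_distrib]
    exact Finset.sum_congr rfl fun y _ => by ring
  rw [h1, hf x hx]
  have : 0 ≤ ∑ y ∈ cell blk Finset.univ x, f y ^ 2 := Finset.sum_nonneg fun _ _ => sq_nonneg _
  linarith

/-- A Poincaré inequality for functions whose averages over all blocks vanish. -/
theorem sum_sq_le_energy (hn : 4 ≤ n) (f : (Option ι → Board n) → ℝ) {ℓ : ℕ}
    (hclose : ∀ v w, blk v = blk w → v.val < w.val + 2 * ℓ)
    (hlarge : ∀ v, ℓ ≤ #(Finset.univ.filter fun w => blk w = blk v))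
    (hℓ : 16 * Fintype.card ι + 40 ≤ ℓ)
    (hf : ∀ x ∈ placements n ι, ∑ y ∈ cell blk Finset.univ x, f y = 0) :
    ∑ x ∈ placements n ι, f x ^ 2 ≤
      9600 * 200 ^ (2 * Fintype.card ι) * n ^ 2 * (n + 4 * ℓ ^ 2) * energy f := by
  have h1 := spread_le hn f hclose hlarge hℓ Finset.univ
  have h2 := sum_cell_sq_le_spread f hf
  have hcard : #(Finset.univ : Finset (ι × Bool)) = 2 * Fintype.card ι := by
    rw [Finset.card_univ, Fintype.card_prod, Fintype.card_bool, mul_comm]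
  have hl0 : (0 : ℝ) < ℓ := by exact_mod_cast (by omega : 0 < ℓ)
  have hn0 : (0 : ℝ) < n := by exact_mod_cast (by omega : 0 < n)
  set K := 2 * Fintype.card ι with hK
  have h3 : (n : ℝ) ^ 2 * ℓ ^ K * ∑ x ∈ placements n ι, f x ^ 2 ≤
      2 * 2 ^ K * ∑ x ∈ placements n ι, #(cell blk Finset.univ x) * f x ^ 2 := by
    rw [Finset.mul_sum, Finset.mul_sum]
    refine Finset.sum_le_sum fun x hx => ?_
    rw [← mul_assoc]
    refine mul_le_mul_of_nonneg_right ?_ (sq_nonneg _)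
    have := le_card_cell hlarge hℓ hx Finset.univ
    rw [hcard] at this
    exact_mod_cast this
  rw [hcard] at h1
  refine le_of_mul_le_mul_left (h3.trans ?_) (by positivity : 0 < (n : ℝ) ^ 2 * ℓ ^ K)
  calc _ ≤ 2 * 2 ^ K * ((100 * (ℓ : ℝ)) ^ K *
        (n ^ 2 * (4800 * n ^ 2 * (n + 4 * ℓ ^ 2) * energy f))) := by
        have := h2.trans h1
        gcongr
    _ = _ := by
        have : (200 : ℝ) ^ K = 2 ^ K * 100 ^ K := by rw [← mul_pow]; norm_num
        rw [this, mul_pow]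
        ring

end BlockAverages

section Blocks

variable {n ℓ : ℕ}

/-- The index of the block of `v`, when `ZMod n` is cut into blocks of length between `ℓ` and
`2 * ℓ`. -/
def blockIndex (n ℓ : ℕ) (v : ZMod n) : ℕ := min (v.val / ℓ) (n / ℓ - 1)

theorem blockIndex_lt (h0 : 0 < ℓ) (h : ℓ ≤ n) (v : ZMod n) : blockIndex n ℓ v < n / ℓ := by
  have : 0 < n / ℓ := Nat.div_pos h h0
  unfold blockIndex
  omega

variable [NeZero n]

theorem val_lt_of_blockIndex_eq (h0 : 0 < ℓ) (v w : ZMod n)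
    (e : blockIndex n ℓ v = blockIndex n ℓ w) : v.val < w.val + 2 * ℓ := by
  have hv := ZMod.val_lt v
  have a1 := Nat.lt_mul_div_succ v.val h0
  have a2 := Nat.mul_div_le w.val ℓ
  have a3 := Nat.lt_mul_div_succ n h0
  unfold blockIndex at e
  by_cases h : v.val / ℓ ≤ w.val / ℓ + 1
  · have := Nat.mul_le_mul_left ℓ (Nat.succ_le_succ h)
    simp only [Nat.succ_eq_add_one] at this
    linarith
  · have h1 : n / ℓ ≤ w.val / ℓ + 1 := by omega
    have := Nat.mul_le_mul_left ℓ (Nat.succ_le_succ h1)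
    simp only [Nat.succ_eq_add_one] at this
    linarith

theorem le_card_blockIndex_eq (h0 : 0 < ℓ) (h : ℓ ≤ n) (v : ZMod n) :
    ℓ ≤ #(Finset.univ.filter fun w => blockIndex n ℓ w = blockIndex n ℓ v) := by
  have hq := blockIndex_lt h0 h v
  set j := blockIndex n ℓ v
  have hn : ℓ * (j + 1) ≤ n := (Nat.mul_le_mul_left ℓ hq).trans (Nat.mul_div_le n ℓ)
  have hi : ∀ i ∈ Finset.range ℓ, j * ℓ + i < n := fun i hi => by
    have := Finset.mem_range.1 hi
    nlinarith
  calc ℓ = #(Finset.range ℓ) := (Finset.card_range ℓ).symm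
    _ ≤ _ := by
      refine Finset.card_le_card_of_injOn (fun i => ((j * ℓ + i : ℕ) : ZMod n)) ?_ ?_
      · intro i hi'
        refine Finset.mem_coe.2 (Finset.mem_filter.2 ⟨Finset.mem_univ _, ?_⟩)
        rw [blockIndex, ZMod.val_cast_of_lt (hi i hi'), mul_comm, Nat.mul_add_div h0,
          Nat.div_eq_of_lt (Finset.mem_range.1 hi')]
        omega
      · intro i hi' i' hi'' e
        have := congrArg ZMod.val e
        simp only at this
        rw [ZMod.val_cast_of_lt (hi i hi'), ZMod.val_cast_of_lt (hi i' hi'')] at this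
        omega

end Blocks

section Spectral

variable {X : Type*} [Fintype X] [DecidableEq X]

open Matrix

/-- A family of eigenvectors of a real symmetric matrix which is an orthonormal basis. -/
structure IsEigenbasis (A : Matrix X X ℝ) (α : X → ℝ) (v : X → X → ℝ) : Prop where
  mulVec_eq : ∀ i, A *ᵥ v i = α i • v i
  dotProduct_eq : ∀ i j, v i ⬝ᵥ v j = if i = j then 1 else 0

theorem exists_isEigenbasis {A : Matrix X X ℝ} (hA : A.IsHermitian) :
    ∃ α v, IsEigenbasis A α v := by
  refine ⟨hA.eigenvalues, fun i => hA.eigenvectorBasis i, fun i => hA.mulVec_eigenvectorBasis i,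
    fun i j => ?_⟩
  have h := orthonormal_iff_ite.1 hA.eigenvectorBasis.orthonormal i j
  rw [← h, EuclideanSpace.inner_eq_star_dotProduct, dotProduct_comm]
  simp

namespace IsEigenbasis

variable {A : Matrix X X ℝ} {α : X → ℝ} {v : X → X → ℝ}

theorem trace_eq (h : IsEigenbasis A α v) (M : Matrix X X ℝ) : M.trace = ∑ i, v i ⬝ᵥ M *ᵥ v i := by
  have h1 : Matrix.of v * (Matrix.of v)ᵀ = 1 := by
    ext i j
    rw [Matrix.mul_apply', Matrix.one_apply]
    exact h.dotProduct_eq i j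
  have h2 : (Matrix.of v)ᵀ * Matrix.of v = 1 := mul_eq_one_comm.1 h1
  calc M.trace = (M * ((Matrix.of v)ᵀ * Matrix.of v)).trace := by rw [h2, mul_one]
    _ = (Matrix.of v * (M * (Matrix.of v)ᵀ)).trace := by
      rw [← mul_assoc, Matrix.trace_mul_comm]
    _ = _ := rfl

theorem pow_mulVec_eq (h : IsEigenbasis A α v) (N : ℕ) (i : X) : (A ^ N) *ᵥ v i = α i ^ N • v i :=
    by
  induction N with
  | zero => simp
  | succ N ih =>
    rw [pow_succ, ← Matrix.mulVec_mulVec, h.mulVec_eq, Matrix.mulVec_smul, ih, smul_smul, pow_succ,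
      mul_comm]

theorem sum_sq_combination (h : IsEigenbasis A α v) (c : X → ℝ) (s : Finset X) :
    ∑ x, (∑ i ∈ s, c i * v i x) ^ 2 = ∑ i ∈ s, c i ^ 2 := by
  calc ∑ x, (∑ i ∈ s, c i * v i x) ^ 2 =
      ∑ i ∈ s, ∑ j ∈ s, c i * c j * (v i ⬝ᵥ v j) := by
        simp_rw [sq, Finset.sum_mul_sum, dotProduct, Finset.mul_sum]
        rw [Finset.sum_comm]
        refine Finset.sum_congr rfl fun i _ => ?_
        rw [Finset.sum_comm]
        exact Finset.sum_congr rfl fun j _ => Finset.sum_congr rfl fun x _ => by ring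
    _ = _ := by
        refine Finset.sum_congr rfl fun i hi => ?_
        simp [h.dotProduct_eq, hi, sq]

theorem abs_trace_pow_mul_le (h : IsEigenbasis A α v) {K : Matrix X X ℝ} (hK : ∀ x y, 0 ≤ K x y)
    (hKs : ∀ x y, K x y = K y x) {D : ℝ} (hD : ∀ x, ∑ y, K x y ≤ D) (N : ℕ) (hA : Aᵀ = A) :
    |(A ^ N * K).trace| ≤ D * ∑ i, |α i| ^ N := by
  have hq : ∀ u : X → ℝ, |u ⬝ᵥ K *ᵥ u| ≤ D * ∑ x, u x ^ 2 := fun u => by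
    have e1 : ∑ x, ∑ y, K x y * u x ^ 2 ≤ D * ∑ x, u x ^ 2 := by
      rw [Finset.mul_sum]
      refine Finset.sum_le_sum fun x _ => ?_
      rw [← Finset.sum_mul]
      exact mul_le_mul_of_nonneg_right (hD x) (sq_nonneg _)
    have e2 : ∑ x, ∑ y, K x y * u y ^ 2 = ∑ x, ∑ y, K x y * u x ^ 2 := by
      rw [Finset.sum_comm]
      exact Finset.sum_congr rfl fun x _ => Finset.sum_congr rfl fun y _ => by rw [hKs]
    calc |u ⬝ᵥ K *ᵥ u| = |∑ x, ∑ y, K x y * (u x * u y)| := by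
          simp only [dotProduct, mulVec, Finset.mul_sum]
          congr 1
          exact Finset.sum_congr rfl fun x _ => Finset.sum_congr rfl fun y _ => by ring
      _ ≤ ∑ x, ∑ y, K x y * ((u x ^ 2 + u y ^ 2) / 2) := by
          refine (Finset.abs_sum_le_sum_abs _ _).trans (Finset.sum_le_sum fun x _ => ?_)
          refine (Finset.abs_sum_le_sum_abs _ _).trans (Finset.sum_le_sum fun y _ => ?_)
          rw [abs_mul, abs_of_nonneg (hK x y)]
          refine mul_le_mul_of_nonneg_left (abs_le.2 ⟨?_, ?_⟩) (hK x y)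
          · nlinarith [sq_nonneg (u x + u y)]
          · nlinarith [sq_nonneg (u x - u y)]
      _ = (∑ x, ∑ y, K x y * u x ^ 2 + ∑ x, ∑ y, K x y * u y ^ 2) / 2 := by
          simp only [← Finset.sum_add_distrib, Finset.sum_div]
          exact Finset.sum_congr rfl fun x _ => Finset.sum_congr rfl fun y _ => by ring
      _ ≤ _ := by rw [e2]; linarith
  rw [h.trace_eq, Finset.mul_sum]
  refine (Finset.abs_sum_le_sum_abs _ _).trans (Finset.sum_le_sum fun i _ => ?_)
  have hu : ∑ x, v i x ^ 2 = 1 := by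
    have := h.dotProduct_eq i i
    rw [if_pos rfl] at this
    rw [← this]
    exact Finset.sum_congr rfl fun x _ => sq _
  have e : v i ⬝ᵥ (A ^ N * K) *ᵥ v i = α i ^ N * (v i ⬝ᵥ K *ᵥ v i) := by
    rw [← Matrix.mulVec_mulVec, Matrix.dotProduct_mulVec, ← Matrix.mulVec_transpose,
      Matrix.transpose_pow, hA, h.pow_mulVec_eq, smul_dotProduct, smul_eq_mul]
  rw [e, abs_mul, abs_pow, mul_comm]
  refine mul_le_mul_of_nonneg_right ?_ (by positivity)
  simpa [hu] using hq (v i)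

/-- If the quadratic form of `A` is smaller than `1 - t` on the kernel of a linear map to a space
of dimension `m`, then `A` has at most `m` eigenvalues larger than `1 - t`. -/
theorem card_le_finrank (h : IsEigenbasis A α v) {Y : Type*} [Fintype Y] (L : (X → ℝ) →ₗ[ℝ] (Y → ℝ))
    (p : X → Prop)
    [DecidablePred p] {t : ℝ} (hp : ∀ i, p i → 1 - t < α i)
    (hL : ∀ c : X → ℝ, L (∑ i ∈ univ.filter p, c i • v i) = 0 →
      (∑ i ∈ univ.filter p, c i • v i) ⬝ᵥ A *ᵥ (∑ i ∈ univ.filter p, c i • v i) ≤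
        (1 - t) * ∑ x, (∑ i ∈ univ.filter p, c i * v i x) ^ 2) :
    #(univ.filter p) ≤ Fintype.card Y := by
  by_contra! hlt
  set s := univ.filter p with hs
  let G : (s → ℝ) →ₗ[ℝ] (X → ℝ) := Fintype.linearCombination ℝ fun i : s => v i
  have hker : LinearMap.ker (L ∘ₗ G) ≠ ⊥ := by
    apply LinearMap.ker_ne_bot_of_finrank_lt
    simpa using hlt
  obtain ⟨a, ha, ha0⟩ := (Submodule.ne_bot_iff _).1 hker
  set c : X → ℝ := fun i => if hi : i ∈ s then a ⟨i, hi⟩ else 0 with hc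
  have hG : G a = ∑ i ∈ s, c i • v i := by
    rw [Fintype.linearCombination_apply, ← Finset.sum_coe_sort s]
    exact Finset.sum_congr rfl fun i _ => by simp [hc]
  have hsum : ∑ i ∈ s, c i ^ 2 = ∑ i : s, a i ^ 2 := by
    rw [← Finset.sum_coe_sort s]
    exact Finset.sum_congr rfl fun i _ => by simp [hc]
  have h1 := hL c (by rw [← hG]; exact ha)
  have h2 : (∑ i ∈ s, c i • v i) ⬝ᵥ A *ᵥ (∑ i ∈ s, c i • v i) = ∑ i ∈ s, α i * c i ^ 2 := by
    rw [Matrix.mulVec_sum, sum_dotProduct]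
    refine Finset.sum_congr rfl fun i hi => ?_
    simp only [Matrix.mulVec_smul, h.mulVec_eq, smul_dotProduct, dotProduct_sum, dotProduct_smul,
      h.dotProduct_eq, smul_eq_mul, mul_ite, mul_one, mul_zero]
    rw [Finset.sum_ite_eq, if_pos hi]
    ring
  rw [h2, h.sum_sq_combination, Finset.mul_sum] at h1
  obtain ⟨i, hi⟩ := Function.ne_iff.1 ha0
  refine absurd h1 (not_le.2 (Finset.sum_lt_sum (fun j hj => ?_) ⟨i.1, i.2, ?_⟩))
  · exact mul_le_mul_of_nonneg_right (hp j (Finset.mem_filter.1 hj).2).le (sq_nonneg _)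
  · refine mul_lt_mul_of_pos_right (hp _ (Finset.mem_filter.1 i.2).2) ?_
    have : c i.1 = a i := by simp [hc]
    rw [this]
    exact sq_pos_of_ne_zero hi

end IsEigenbasis

end Spectral

section Walk

open Matrix

variable {n : ℕ} [NeZero n] {ι : Type} [Fintype ι] [DecidableEq ι]

/-- Placements as a type. -/
abbrev Placement (n : ℕ) [NeZero n] (ι : Type) [Fintype ι] [DecidableEq ι] : Type :=
  {x : Option ι → Board n // x ∈ placements n ι}

/-- `slide` on placements. -/
def Placement.slide (d : Board n) (x : Placement n ι) : Placement n ι :=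
  ⟨_root_.slide none d x.1, slide_mem_placements x.2⟩

theorem Placement.slide_neg_slide (d : Board n) (x : Placement n ι) :
    Placement.slide (-d) (Placement.slide d x) = x :=
  Subtype.ext (_root_.slide_neg_slide none d x.1)

theorem Placement.slide_slide_neg (d : Board n) (x : Placement n ι) :
    Placement.slide d (Placement.slide (-d) x) = x := by
  simpa using Placement.slide_neg_slide (-d) x

/-- Sliding as a permutation of the placements. -/
def Placement.slideEquiv (d : Board n) : Equiv.Perm (Placement n ι) where
  toFun := Placement.slide d
  invFun := Placement.slide (-d)
  left_inv := Placement.slide_neg_slide d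
  right_inv := Placement.slide_slide_neg d

theorem Placement.slide_eq_iff (d : Board n) (x y : Placement n ι) :
    Placement.slide d x = y ↔ Placement.slide (-d) y = x :=
  ⟨fun h => by rw [← h, slide_neg_slide], fun h => by rw [← h, slide_slide_neg]⟩

theorem neg_mem_displacements {d : Board n} (h : d ∈ displacements n) :
    -d ∈ displacements n := by
  simp only [displacements, Finset.mem_insert, Finset.mem_singleton] at h ⊢
  rcases h with rfl | rfl | rfl | rfl | rfl <;> simp

theorem card_displacements (hn : 3 ≤ n) : #(displacements n) = 5 := by
  have h1 : ((1 : ℕ) : ZMod n) ≠ 0 := fun h => by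
    rw [ZMod.natCast_eq_zero_iff] at h
    have := Nat.le_of_dvd one_pos h
    omega
  have h2 : ((2 : ℕ) : ZMod n) ≠ 0 := fun h => by
    rw [ZMod.natCast_eq_zero_iff] at h
    have := Nat.le_of_dvd two_pos h
    omega
  have h3 : (1 : ZMod n) ≠ -1 := fun h => h2 (by push_cast; linear_combination h)
  rw [Nat.cast_one] at h1
  have h4 : (-1 : ZMod n) ≠ 0 := neg_ne_zero.2 h1
  rw [displacements, Finset.card_insert_of_notMem, Finset.card_insert_of_notMem,
    Finset.card_insert_of_notMem, Finset.card_insert_of_notMem, Finset.card_singleton] <;>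
  simp [h1, h3, h1.symm, h4.symm]

/-- The transition matrix of the positions of the empty square and of the pieces. -/
noncomputable def walk (n : ℕ) [NeZero n] (ι : Type) [Fintype ι] [DecidableEq ι] :
    Matrix (Placement n ι) (Placement n ι) ℝ :=
  Matrix.of fun x y => 1 / 5 * ∑ d ∈ displacements n, if Placement.slide d x = y then 1 else 0

theorem walk_mulVec (g : Placement n ι → ℝ) (x : Placement n ι) :
    (walk n ι *ᵥ g) x = 1 / 5 * ∑ d ∈ displacements n, g (Placement.slide d x) := by
  simp only [walk, mulVec, dotProduct, Matrix.of_apply, mul_assoc, Finset.sum_mul,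
    ← Finset.mul_sum]
  rw [Finset.sum_comm]
  simp

theorem walk_transpose : (walk n ι)ᵀ = walk n ι := by
  ext x y
  simp only [walk, Matrix.transpose_apply, Matrix.of_apply]
  congr 1
  refine Finset.sum_nbij' (fun d => -d) (fun d => -d) (fun d h => neg_mem_displacements h)
    (fun d h => neg_mem_displacements h) (fun _ _ => neg_neg _) (fun _ _ => neg_neg _) ?_
  intro d _
  simp only [Placement.slide_eq_iff d]

theorem sum_slide (d : Board n) (g : Placement n ι → ℝ) :
    ∑ x, g (Placement.slide d x) = ∑ x, g x :=
  Equiv.sum_comp (Placement.slideEquiv d) g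

theorem dotProduct_walk (g : Placement n ι → ℝ) : g ⬝ᵥ walk n ι *ᵥ g =
    1 / 5 * ∑ d ∈ displacements n, ∑ x, g x * g (Placement.slide d x) := by
  rw [Finset.sum_comm, dotProduct, Finset.mul_sum]
  refine Finset.sum_congr rfl fun x _ => ?_
  rw [walk_mulVec, ← Finset.mul_sum]
  ring

theorem sum_sub_sq_eq (hn : 3 ≤ n) (g : Placement n ι → ℝ) :
    ∑ d ∈ displacements n, ∑ x, (g (Placement.slide d x) - g x) ^ 2 =
      10 * (∑ x, g x ^ 2 - g ⬝ᵥ walk n ι *ᵥ g) := by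
  have h : ∀ d ∈ displacements n, ∑ x, (g (Placement.slide d x) - g x) ^ 2 =
      2 * ∑ x, g x ^ 2 - 2 * ∑ x, g x * g (Placement.slide d x) := fun d _ => by
    have h1 := sum_slide d fun x => g x ^ 2
    rw [two_mul (∑ x, g x ^ 2)]
    nth_rewrite 1 [← h1]
    rw [← Finset.sum_add_distrib, Finset.mul_sum, ← Finset.sum_sub_distrib]
    exact Finset.sum_congr rfl fun x _ => by ring
  rw [Finset.sum_congr rfl h, Finset.sum_sub_distrib, Finset.sum_const, card_displacements hn,
    ← Finset.mul_sum, dotProduct_walk, nsmul_eq_mul]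
  push_cast
  ring

theorem neg_le_dotProduct_walk (hn : 3 ≤ n) (g : Placement n ι → ℝ) :
    -(3 / 5) * ∑ x, g x ^ 2 ≤ g ⬝ᵥ walk n ι *ᵥ g := by
  have h : ∀ d ∈ displacements n, ∑ x, (g (Placement.slide d x) + g x) ^ 2 =
      2 * ∑ x, g x ^ 2 + 2 * ∑ x, g x * g (Placement.slide d x) := fun d _ => by
    have h1 := sum_slide d fun x => g x ^ 2
    rw [two_mul (∑ x, g x ^ 2)]
    nth_rewrite 1 [← h1]
    rw [← Finset.sum_add_distrib, Finset.mul_sum, ← Finset.sum_add_distrib]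
    exact Finset.sum_congr rfl fun x _ => by ring
  have h2 := Finset.sum_congr rfl h
  rw [Finset.sum_add_distrib, Finset.sum_const, card_displacements hn,
    ← Finset.mul_sum, nsmul_eq_mul] at h2
  have h3 := Finset.single_le_sum (f := fun d => ∑ x, (g (Placement.slide d x) + g x) ^ 2)
    (fun d _ => Finset.sum_nonneg fun x _ => sq_nonneg _)
    (by simp [displacements] : ((0 : ZMod n), (0 : ZMod n)) ∈ displacements n)
  have h4 : ∑ x, (g (Placement.slide ((0 : ZMod n), (0 : ZMod n)) x) + g x) ^ 2 =
      4 * ∑ x, g x ^ 2 := by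
    rw [Finset.mul_sum]
    refine Finset.sum_congr rfl fun x _ => ?_
    have : Placement.slide ((0 : ZMod n), (0 : ZMod n)) x = x := by
      refine Subtype.ext ?_
      funext l
      have : ((0 : ZMod n), (0 : ZMod n)) = (0 : Board n) := rfl
      simp [Placement.slide, _root_.slide, this]
    rw [this]; ring
  rw [h4, h2] at h3
  rw [dotProduct_walk]
  push_cast at h3
  linarith

/-- Extension of a function on placements by zero. -/
noncomputable def zeroExtend (g : Placement n ι → ℝ) (x : Option ι → Board n) : ℝ :=
  if h : x ∈ placements n ι then g ⟨x, h⟩ else 0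

theorem zeroExtend_coe (g : Placement n ι → ℝ) (x : Placement n ι) : zeroExtend g x.1 = g x :=
  dif_pos x.2

theorem energy_zeroExtend (hn : 3 ≤ n) (g : Placement n ι → ℝ) :
    energy (zeroExtend g) = 10 * (∑ x, g x ^ 2 - g ⬝ᵥ walk n ι *ᵥ g) := by
  rw [← sum_sub_sq_eq hn, energy, ← Finset.sum_coe_sort, Finset.sum_comm]
  refine Finset.sum_congr rfl fun d _ => Finset.sum_congr rfl fun x _ => ?_
  rw [zeroExtend_coe, ← zeroExtend_coe g (Placement.slide d x)]
  rfl

theorem sum_zeroExtend_sq (g : Placement n ι → ℝ) :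
    ∑ x ∈ placements n ι, zeroExtend g x ^ 2 = ∑ x, g x ^ 2 := by
  rw [← Finset.sum_coe_sort]
  exact Finset.sum_congr rfl fun x _ => by rw [zeroExtend_coe]

/-- The matrix with constant entries and row sums `1`. -/
noncomputable def averaging (X : Type*) [Fintype X] : Matrix X X ℝ :=
  Matrix.of fun _ _ => (Fintype.card X : ℝ)⁻¹

theorem averaging_transpose (X : Type*) [Fintype X] : (averaging X)ᵀ = averaging X := rfl

theorem averaging_mul_self (X : Type*) [Fintype X] [Nonempty X] :
    averaging X * averaging X = averaging X := by
  ext x y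
  simp [averaging, Matrix.mul_apply]

theorem averaging_mulVec {X : Type*} [Fintype X] {g : X → ℝ} (hg : ∑ x, g x = 0) :
    averaging X *ᵥ g = 0 := by
  ext x
  simp [averaging, mulVec, dotProduct, ← Finset.mul_sum, hg]

theorem walk_mul_averaging (hn : 3 ≤ n) :
    walk n ι * averaging (Placement n ι) = averaging (Placement n ι) := by
  ext x y
  have : (walk n ι * averaging (Placement n ι)) x y =
      (walk n ι *ᵥ fun x => averaging (Placement n ι) x y) x := rfl
  rw [this, walk_mulVec]
  simp [averaging, card_displacements hn]

theorem averaging_mul_walk (hn : 3 ≤ n) :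
    averaging (Placement n ι) * walk n ι = averaging (Placement n ι) := by
  have := congrArg Matrix.transpose (walk_mul_averaging (ι := ι) hn)
  rwa [Matrix.transpose_mul, walk_transpose, averaging_transpose] at this

theorem walk_pow_eq (hn : 3 ≤ n) [Nonempty (Placement n ι)] (N : ℕ) :
    walk n ι ^ (N + 1) = averaging (Placement n ι) +
      (walk n ι - averaging (Placement n ι)) ^ (N + 1) := by
  set J := averaging (Placement n ι) with hJ
  have h1 : J * J = J := averaging_mul_self _
  have h2 : walk n ι * J = J := walk_mul_averaging hn
  have h3 : J * walk n ι = J := averaging_mul_walk hn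
  induction N with
  | zero => simp
  | succ N ih =>
    have h4 : J * (walk n ι - J) ^ (N + 1) = 0 := by
      rw [pow_succ', ← mul_assoc, mul_sub, h3, h1, sub_self, zero_mul]
    rw [pow_succ', ih, mul_add, h2]
    conv_rhs => rw [pow_succ', sub_mul, h4, sub_zero]

end Walk

section SpectralGap

open Matrix

variable {n : ℕ} [NeZero n] {ι : Type} [Fintype ι] [DecidableEq ι]

/-- The Dirichlet eigenvalue bound at scale `ℓ` for `k` pieces. -/
noncomputable def scaleGap (k n ℓ : ℕ) : ℝ :=
  (96000 * 200 ^ (2 * k) * n ^ 2 * (n + 4 * ℓ ^ 2))⁻¹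

theorem scaleGap_mul_sum_sq_le (hn : 4 ≤ n) {ℓ : ℕ} (hℓ : 16 * Fintype.card ι + 40 ≤ ℓ)
    (hℓn : ℓ ≤ n) (g : Placement n ι → ℝ)
    (hg : ∀ β : ι × Bool → ℕ,
      ∑ y ∈ univ.filter (fun y : Placement n ι => ∀ c, blockIndex n ℓ (coord y.1 c) = β c),
        g y = 0) :
    scaleGap (Fintype.card ι) n ℓ * ∑ x, g x ^ 2 ≤ ∑ x, g x ^ 2 - g ⬝ᵥ walk n ι *ᵥ g := by
  have h0 : 0 < ℓ := by omega
  have h := sum_sq_le_energy hn (zeroExtend g) (val_lt_of_blockIndex_eq h0)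
    (le_card_blockIndex_eq h0 hℓn) hℓ fun x _ => by
      rw [← hg fun c => blockIndex n ℓ (coord x c), cell, Finset.sum_filter,
        ← Finset.sum_coe_sort, Finset.sum_filter]
      refine Finset.sum_congr rfl fun y _ => ?_
      rw [zeroExtend_coe]
      simp only [Finset.mem_univ, not_true_eq_false, false_imp_iff, implies_true, and_true]
  rw [sum_zeroExtend_sq, energy_zeroExtend (by omega)] at h
  have hl0 : (0 : ℝ) < ℓ := by exact_mod_cast h0
  have hn0 : (0 : ℝ) < n := by exact_mod_cast (by omega : 0 < n)
  have hpos : 0 < 96000 * 200 ^ (2 * Fintype.card ι) * (n : ℝ) ^ 2 * (n + 4 * ℓ ^ 2) := by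
    positivity
  rw [scaleGap, inv_mul_le_iff₀ hpos]
  refine h.trans (le_of_eq ?_)
  ring

variable {α : Placement n ι → ℝ} {v : Placement n ι → Placement n ι → ℝ}

theorem sum_combination_eq_zero {X : Type*} [Fintype X] {v : X → X → ℝ} (s : Finset X)
    (c : X → ℝ) (h : ∀ i ∈ s, ∑ x, v i x = 0) : ∑ x, (∑ i ∈ s, c i • v i) x = 0 := by
  simp only [Finset.sum_apply, Pi.smul_apply, smul_eq_mul]
  rw [Finset.sum_comm]
  exact Finset.sum_eq_zero fun i hi => by rw [← Finset.mul_sum, h i hi, mul_zero]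

namespace IsEigenbasis


theorem sum_eq_zero (h : IsEigenbasis (walk n ι - averaging (Placement n ι)) α v) (hn : 3 ≤ n)
    {i : Placement n ι} (hi : α i ≠ 0) : ∑ x, v i x = 0 := by
  have hne : Nonempty (Placement n ι) := ⟨i⟩
  have h1 : averaging (Placement n ι) * (walk n ι - averaging (Placement n ι)) = 0 := by
    rw [mul_sub, averaging_mul_walk hn, averaging_mul_self, sub_self]
  have h2 : averaging (Placement n ι) *ᵥ ((walk n ι - averaging (Placement n ι)) *ᵥ v i) = 0 := by
    rw [Matrix.mulVec_mulVec, h1, Matrix.zero_mulVec]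
  rw [h.mulVec_eq, Matrix.mulVec_smul] at h2
  have h3 := congrFun ((smul_eq_zero.1 h2).resolve_left hi) i
  simp only [averaging, mulVec, dotProduct, Matrix.of_apply, ← Finset.mul_sum,
    Pi.zero_apply] at h3
  exact (mul_eq_zero.1 h3).resolve_left (inv_ne_zero (Nat.cast_ne_zero.2 Fintype.card_ne_zero))

theorem dotProduct_walk_eq (h : IsEigenbasis (walk n ι - averaging (Placement n ι)) α v)
    (hn : 3 ≤ n) {i : Placement n ι} (hi : α i ≠ 0) :
    v i ⬝ᵥ walk n ι *ᵥ v i = α i := by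
  have h1 := h.mulVec_eq i
  rw [Matrix.sub_mulVec, averaging_mulVec (h.sum_eq_zero hn hi), sub_zero] at h1
  rw [h1, dotProduct_smul, h.dotProduct_eq, if_pos rfl, smul_eq_mul, mul_one]

theorem sum_sq_eq_one (h : IsEigenbasis (walk n ι - averaging (Placement n ι)) α v)
    (i : Placement n ι) : ∑ x, v i x ^ 2 = 1 := by
  have := h.dotProduct_eq i i
  rw [if_pos rfl] at this
  rw [← this]
  exact Finset.sum_congr rfl fun x _ => sq _

theorem abs_le_exp (h : IsEigenbasis (walk n ι - averaging (Placement n ι)) α v) (hn : 3 ≤ n)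
    (i : Placement n ι) : |α i| ≤ Real.exp (-(1 - α i) / 4) := by
  by_cases hi : α i = 0
  · rw [hi, abs_zero]; positivity
  have h1 := neg_le_dotProduct_walk hn (v i)
  have h2 := energy_nonneg (zeroExtend (v i))
  rw [energy_zeroExtend hn] at h2
  rw [h.dotProduct_walk_eq hn hi, h.sum_sq_eq_one] at h1 h2
  have h3 := Real.add_one_le_exp (-(1 - α i) / 4)
  refine le_trans ?_ h3
  rw [abs_le]
  constructor <;> linarith

theorem le_one_sub_scaleGap (h : IsEigenbasis (walk n ι - averaging (Placement n ι)) α v)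
    (hn : 4 ≤ n) (hk : 16 * Fintype.card ι + 40 ≤ n) {i : Placement n ι}
    (hi : α i ≠ 0) : scaleGap (Fintype.card ι) n n ≤ 1 - α i := by
  have h1 := scaleGap_mul_sum_sq_le hn hk le_rfl (v i) fun β => by
    have hb : ∀ v, blockIndex n n v = 0 := fun v => by
      simp [blockIndex, Nat.div_self (by omega : 0 < n)]
    simp only [hb]
    by_cases hβ : ∀ c, 0 = β c
    · rw [Finset.filter_true_of_mem fun _ _ => hβ]
      exact h.sum_eq_zero (by omega) hi
    · rw [Finset.filter_false_of_mem fun _ _ => hβ, Finset.sum_empty]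
  rwa [h.sum_sq_eq_one, mul_one, h.dotProduct_walk_eq (by omega) hi] at h1

theorem card_filter_le (h : IsEigenbasis (walk n ι - averaging (Placement n ι)) α v) (hn : 4 ≤ n)
    {ℓ : ℕ} (hℓ : 16 * Fintype.card ι + 40 ≤ ℓ) (hℓn : ℓ ≤ n) :
    #(univ.filter fun i => α i ≠ 0 ∧ 1 - α i < scaleGap (Fintype.card ι) n ℓ) ≤
      (n / ℓ) ^ (2 * Fintype.card ι) := by
  have h0 : 0 < ℓ := by omega
  let L : (Placement n ι → ℝ) →ₗ[ℝ] ((ι × Bool → Fin (n / ℓ)) → ℝ) :=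
    { toFun := fun g β => ∑ y ∈ univ.filter
        (fun y : Placement n ι => ∀ c, blockIndex n ℓ (coord y.1 c) = β c), g y
      map_add' := fun g g' => by ext β; simp [Finset.sum_add_distrib]
      map_smul' := fun a g => by ext β; simp [Finset.mul_sum] }
  refine (h.card_le_finrank L _ (t := scaleGap (Fintype.card ι) n ℓ)
    (fun i hi => by linarith [hi.2]) fun c hc => ?_).trans (le_of_eq ?_)
  · set g := ∑ i ∈ univ.filter fun i => α i ≠ 0 ∧ 1 - α i < scaleGap (Fintype.card ι) n ℓ,
      c i • v i with hg
    have hg0 : ∑ x, g x = 0 := sum_combination_eq_zero _ _ fun i hi =>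
      h.sum_eq_zero (by omega) (Finset.mem_filter.1 hi).2.1
    have h1 := scaleGap_mul_sum_sq_le hn hℓ hℓn g fun β => by
      by_cases hβ : ∀ c, β c < n / ℓ
      · exact congrFun hc fun c => ⟨β c, hβ c⟩
      · refine Finset.sum_eq_zero fun y hy => absurd (fun c => ?_) hβ
        rw [← (Finset.mem_filter.1 hy).2 c]
        exact blockIndex_lt h0 hℓn _
    rw [Matrix.sub_mulVec, averaging_mulVec hg0, sub_zero]
    have h2 : ∀ x, (∑ i ∈ univ.filter fun i => α i ≠ 0 ∧ 1 - α i <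
        scaleGap (Fintype.card ι) n ℓ, c i * v i x) = g x := fun x => by simp [hg]
    simp only [h2]
    linarith
  · simp [mul_comm]

end IsEigenbasis

end SpectralGap

section HeatTrace

/-- A bound for heat traces with polynomially many eigenvalues at each scale. -/
noncomputable def heatBound (m : ℕ) (c : ℝ) : ℝ :=
  ∑' R : ℕ, (4 * (R : ℝ) ^ 2) ^ (m + 2) * Real.exp (-(c / 4) * R)

theorem summable_heatBound (m : ℕ) {c : ℝ} (hc : 0 < c) :
    Summable fun R : ℕ => (4 * (R : ℝ) ^ 2) ^ (m + 2) * Real.exp (-(c / 4) * R) := by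
  have h := (Real.summable_pow_mul_exp_neg_nat_mul (2 * (m + 2))
    (by positivity : 0 < c / 4)).mul_left ((4 : ℝ) ^ (m + 2))
  refine h.congr fun R => ?_
  rw [mul_pow, ← pow_mul, mul_assoc]

theorem sum_exp_le_heatBound {X : Type*} (s : Finset X) (b : X → ℝ) {c : ℝ} (hc : 0 < c)
    {m M : ℕ} (hM : 1 ≤ M) (h1 : ∀ i ∈ s, c ≤ b i)
    (hcount : ∀ R : ℕ, 1 ≤ R → R ≤ M → #(s.filter fun i => b i < c * R ^ 2) ≤ (2 * R) ^ m)
    (hs : #s ≤ (4 * M ^ 2) ^ (m + 2)) :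
    ∑ i ∈ s, Real.exp (-b i / 4) ≤ heatBound m c := by
  classical
  set r : X → ℕ := fun i => Nat.findGreatest (fun R => c * (R : ℝ) ^ 2 ≤ b i) M with hr
  have hr1 : ∀ i ∈ s, 1 ≤ r i := fun i hi => Nat.le_findGreatest hM (by simpa using h1 i hi)
  have hrM : ∀ i, r i ≤ M := fun i => Nat.findGreatest_le M
  have hrb : ∀ i ∈ s, c * (r i : ℝ) ^ 2 ≤ b i := fun i hi =>
    Nat.findGreatest_spec (P := fun R : ℕ => c * (R : ℝ) ^ 2 ≤ b i) hM (by simpa using h1 i hi)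
  have hrg : ∀ i, r i < M → b i < c * ((r i + 1 : ℕ) : ℝ) ^ 2 := fun i hi =>
    not_le.1 (Nat.findGreatest_is_greatest (P := fun R : ℕ => c * (R : ℝ) ^ 2 ≤ b i)
      (Nat.lt_succ_self _) hi)
  have hcard : ∀ R ∈ Finset.Icc 1 M, #(s.filter fun i => r i = R) ≤ (4 * R ^ 2) ^ (m + 2) := by
    intro R hR
    obtain ⟨hR1, hRM⟩ := Finset.mem_Icc.1 hR
    rcases hRM.lt_or_eq with hlt | rfl
    · have h2 : s.filter (fun i => r i = R) ⊆
          s.filter fun i => b i < c * ((R + 1 : ℕ) : ℝ) ^ 2 := fun i hi => by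
        obtain ⟨h3, h4⟩ := Finset.mem_filter.1 hi
        refine Finset.mem_filter.2 ⟨h3, ?_⟩
        have := hrg i (by omega)
        rwa [h4] at this
      refine (Finset.card_le_card h2).trans ((hcount _ (by omega) hlt).trans ?_)
      have h5 : 2 * (R + 1) ≤ 4 * R ^ 2 := by nlinarith
      exact (Nat.pow_le_pow_left h5 m).trans (Nat.pow_le_pow_right (by nlinarith) (by omega))
    · exact (Finset.card_filter_le _ _).trans hs
  calc ∑ i ∈ s, Real.exp (-b i / 4) ≤ ∑ i ∈ s, Real.exp (-(c / 4) * r i) := by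
        refine Finset.sum_le_sum fun i hi => Real.exp_le_exp.2 ?_
        have h2 := hrb i hi
        have h3 : (1 : ℝ) ≤ r i := by exact_mod_cast hr1 i hi
        have h4 : (r i : ℝ) ≤ r i ^ 2 := by nlinarith
        nlinarith [mul_le_mul_of_nonneg_left h4 hc.le]
    _ = ∑ R ∈ Finset.Icc 1 M, ∑ i ∈ s.filter (fun i => r i = R), Real.exp (-(c / 4) * r i) :=
        (Finset.sum_fiberwise_of_maps_to
          (fun i hi => Finset.mem_Icc.2 ⟨hr1 i hi, hrM i⟩) _).symm
    _ ≤ ∑ R ∈ Finset.Icc 1 M, (4 * (R : ℝ) ^ 2) ^ (m + 2) * Real.exp (-(c / 4) * R) := by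
        refine Finset.sum_le_sum fun R hR => ?_
        rw [Finset.sum_congr rfl fun i hi => by rw [(Finset.mem_filter.1 hi).2],
          Finset.sum_const, nsmul_eq_mul]
        refine mul_le_mul_of_nonneg_right ?_ (Real.exp_pos _).le
        exact_mod_cast hcard R hR
    _ ≤ heatBound m c := (summable_heatBound m hc).sum_le_tsum _ fun R _ => by positivity

variable {n : ℕ} [NeZero n] {ι : Type} [Fintype ι] [DecidableEq ι]

/-- The spectral gap for `k` pieces, in units of `n⁻⁴`. -/
noncomputable def gapConst (k : ℕ) : ℝ := (480000 * 200 ^ (2 * k))⁻¹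

theorem gapConst_pos (k : ℕ) : 0 < gapConst k := by unfold gapConst; positivity

theorem gapConst_mul_sq_le {k R ℓ : ℕ} (hn : 0 < n) (hR : R ^ 2 ≤ n) (hℓ : R * ℓ ≤ n) :
    gapConst k * R ^ 2 ≤ n ^ 4 * scaleGap k n ℓ := by
  have hn0 : (0 : ℝ) < n := by exact_mod_cast hn
  have h1 : (R : ℝ) ^ 2 ≤ n := by exact_mod_cast hR
  have h2 : (R : ℝ) * ℓ ≤ n := by exact_mod_cast hℓ
  have h3 : (R : ℝ) ^ 2 * (n + 4 * ℓ ^ 2) ≤ 5 * n ^ 2 := by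
    have h4 : ((R : ℝ) * ℓ) ^ 2 ≤ n ^ 2 := by gcongr
    nlinarith
  have hpos : 0 < (n : ℝ) + 4 * ℓ ^ 2 := by positivity
  have e : (n : ℝ) ^ 4 * scaleGap k n ℓ = (n ^ 2) / (96000 * 200 ^ (2 * k) * (n + 4 * ℓ ^ 2)) := by
    rw [scaleGap]
    field_simp
  have e2 : gapConst k * R ^ 2 = R ^ 2 / (480000 * 200 ^ (2 * k)) := by
    rw [gapConst]; ring
  rw [e, e2, div_le_div_iff₀ (by positivity) (by positivity)]
  have : (0 : ℝ) < 96000 * 200 ^ (2 * k) := by positivity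
  nlinarith [mul_le_mul_of_nonneg_left h3 this.le]

theorem card_placement_le : Fintype.card (Placement n ι) ≤ n ^ (2 * Fintype.card ι + 2) := by
  refine (Fintype.card_subtype_le _).trans (le_of_eq ?_)
  rw [Fintype.card_fun, Fintype.card_prod, ZMod.card, Fintype.card_option, ← sq, ← pow_mul]
  ring

theorem IsEigenbasis.sum_abs_pow_le {α : Placement n ι → ℝ}
    {v : Placement n ι → Placement n ι → ℝ}
    (h : IsEigenbasis (walk n ι - averaging (Placement n ι)) α v)
    (hn : (16 * Fintype.card ι + 40) ^ 2 ≤ n) {F : ℕ} (hF : 1 ≤ F) :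
    ∑ i, |α i| ^ (n ^ 4 * F) ≤ heatBound (2 * Fintype.card ι) (gapConst (Fintype.card ι)) *
      Real.exp (-(gapConst (Fintype.card ι) / 4) * (F - 1)) := by
  classical
  set k := Fintype.card ι with hk
  set c := gapConst k with hc
  have hc0 : 0 < c := gapConst_pos k
  have hkn : 16 * k + 40 ≤ n := (Nat.le_self_pow (by norm_num) _).trans hn
  have hn4 : 4 ≤ n := by omega
  have hn0 : (0 : ℝ) < n := by exact_mod_cast (by omega : 0 < n)
  have hsq : 16 * k + 40 ≤ Nat.sqrt n := Nat.le_sqrt'.2 hn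
  have hsn := Nat.sqrt_le' n
  have hns := Nat.lt_succ_sqrt' n
  set s := univ.filter fun i => α i ≠ 0 with hs
  have hb1 : ∀ i ∈ s, c ≤ n ^ 4 * (1 - α i) := fun i hi => by
    have h1 := h.le_one_sub_scaleGap hn4 hkn (Finset.mem_filter.1 hi).2
    have h2 := gapConst_mul_sq_le (n := n) (k := k) (R := 1) (ℓ := n) (by omega) (by omega)
      (by omega)
    rw [Nat.cast_one, one_pow, mul_one] at h2
    exact h2.trans (mul_le_mul_of_nonneg_left h1 (by positivity))
  have hheat := sum_exp_le_heatBound s (fun i => n ^ 4 * (1 - α i)) hc0 (m := 2 * k)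
    (M := Nat.sqrt n) (by omega) hb1 (fun R hR1 hRM => ?_) ?_
  · calc ∑ i, |α i| ^ (n ^ 4 * F) = ∑ i ∈ s, |α i| ^ (n ^ 4 * F) := by
          refine (Finset.sum_subset (Finset.subset_univ _) fun i _ hi => ?_).symm
          have : α i = 0 := by simpa [hs] using hi
          rw [this, abs_zero, zero_pow]
          positivity
      _ ≤ ∑ i ∈ s, Real.exp (-(n ^ 4 * (1 - α i)) / 4) * Real.exp (-(c / 4) * (F - 1)) := by
          refine Finset.sum_le_sum fun i hi => ?_
          refine (pow_le_pow_left₀ (abs_nonneg _) (h.abs_le_exp (by omega) i) _).trans ?_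
          rw [← Real.exp_nat_mul, ← Real.exp_add]
          refine Real.exp_le_exp.2 ?_
          push_cast
          have h1 := hb1 i hi
          have h2 : (1 : ℝ) ≤ F := by exact_mod_cast hF
          nlinarith [mul_le_mul_of_nonneg_right h1 (sub_nonneg.2 h2)]
      _ ≤ _ := by
          rw [← Finset.sum_mul]
          exact mul_le_mul_of_nonneg_right hheat (Real.exp_pos _).le
  · have hRsq : R ^ 2 ≤ n := (Nat.pow_le_pow_left hRM 2).trans hsn
    have hdiv : Nat.sqrt n ≤ n / R := by
      rw [Nat.le_div_iff_mul_le (by omega)]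
      nlinarith
    have h1 := h.card_filter_le hn4 (ℓ := n / R) (by omega) (Nat.div_le_self _ _)
    have h2 : n / (n / R) ≤ 2 * R := by
      have h3 : n < R * (n / R + 1) := Nat.lt_mul_div_succ n (by omega)
      refine Nat.div_le_of_le_mul ?_
      nlinarith
    refine le_trans (Finset.card_le_card fun i hi => ?_)
      (h1.trans (Nat.pow_le_pow_left h2 _))
    obtain ⟨h3, h4⟩ := Finset.mem_filter.1 hi
    refine Finset.mem_filter.2 ⟨Finset.mem_univ _, (Finset.mem_filter.1 h3).2, ?_⟩
    have h5 := gapConst_mul_sq_le (k := k) (by omega) hRsq (Nat.mul_div_le n R)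
    exact lt_of_mul_lt_mul_left (h4.trans_le h5) (by positivity)
  · refine (Finset.card_le_univ _).trans (card_placement_le.trans ?_)
    refine Nat.pow_le_pow_left ?_ _
    nlinarith

end HeatTrace

section Moments

open Matrix

variable {n : ℕ} [NeZero n] {ι : Type} [Fintype ι] [DecidableEq ι]

open Classical in
/-- The matrix of the relation of having the pieces in the same positions. -/
noncomputable def agreement (n : ℕ) [NeZero n] (ι : Type) [Fintype ι] [DecidableEq ι] :
    Matrix (Placement n ι) (Placement n ι) ℝ :=
  Matrix.of fun x y => if ∀ i, x.1 (some i) = y.1 (some i) then 1 else 0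

theorem agreement_nonneg (x y : Placement n ι) : 0 ≤ agreement n ι x y := by
  simp only [agreement, Matrix.of_apply]
  split_ifs <;> norm_num

theorem agreement_symm (x y : Placement n ι) : agreement n ι x y = agreement n ι y x := by
  simp only [agreement, Matrix.of_apply, eq_comm]

theorem sum_agreement (x : Placement n ι) :
    ∑ y, agreement n ι x y = n ^ 2 - Fintype.card ι := by
  classical
  have hx : Function.Injective x.1 := mem_placements.1 x.2
  set T : Finset (Board n) := Finset.univ.image fun i => x.1 (some i) with hT
  have hTc : #T = Fintype.card ι := by
    rw [hT, Finset.card_image_of_injective _ fun i j h => Option.some_injective _ (hx h),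
      Finset.card_univ]
  have h1 : #(univ.filter fun y : Placement n ι => ∀ i, x.1 (some i) = y.1 (some i)) = #Tᶜ := by
    refine Finset.card_nbij (fun y => y.1 none) ?_ ?_ ?_
    · intro y hy
      have hy' := (Finset.mem_filter.1 hy).2
      refine Finset.mem_compl.2 fun hmem => ?_
      obtain ⟨i, -, hi⟩ := Finset.mem_image.1 hmem
      rw [hy' i] at hi
      exact absurd (mem_placements.1 y.2 hi) (by simp)
    · intro y hy z hz e
      have hy' := (Finset.mem_filter.1 hy).2
      have hz' := (Finset.mem_filter.1 hz).2
      refine Subtype.ext (funext fun l => ?_)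
      cases l with
      | none => exact e
      | some i => rw [← hy' i, hz' i]
    · intro p hp
      have hp' := Finset.mem_compl.1 hp
      refine ⟨⟨Function.update x.1 none p, mem_placements.2 (hx.update_of_notMem _ ?_)⟩, ?_, ?_⟩
      · intro l hl e
        cases l with
        | none => exact hl rfl
        | some i => exact hp' (Finset.mem_image.2 ⟨i, Finset.mem_univ _, e⟩)
      · exact Finset.mem_coe.2 (Finset.mem_filter.2 ⟨Finset.mem_univ _, fun i => by simp⟩)
      · simp
  have h2 : #T + #Tᶜ = n ^ 2 := by
    rw [Finset.card_add_card_compl, Fintype.card_prod, ZMod.card, sq]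
  simp only [agreement, Matrix.of_apply]
  rw [Finset.sum_boole]
  have h3 : (#T : ℝ) + #Tᶜ = n ^ 2 := by exact_mod_cast h2
  rw [← h3, hTc, ← h1]
  ring

theorem trace_averaging_mul_agreement [Nonempty (Placement n ι)] :
    (averaging (Placement n ι) * agreement n ι).trace = n ^ 2 - Fintype.card ι := by
  have hX : (Fintype.card (Placement n ι) : ℝ) ≠ 0 := Nat.cast_ne_zero.2 Fintype.card_ne_zero
  simp only [Matrix.trace, Matrix.diag_apply, Matrix.mul_apply, averaging, Matrix.of_apply,
    ← Finset.mul_sum]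
  rw [Finset.sum_comm, Finset.sum_congr rfl fun x _ => sum_agreement x, Finset.sum_const,
    Finset.card_univ, nsmul_eq_mul, ← mul_assoc, inv_mul_cancel₀ hX, one_mul]

theorem abs_trace_sub_le (hn : (16 * Fintype.card ι + 40) ^ 2 ≤ n) [Nonempty (Placement n ι)]
    {F : ℕ} (hF : 1 ≤ F) :
    |(walk n ι ^ (n ^ 4 * F) * agreement n ι).trace - (n ^ 2 - Fintype.card ι)| ≤
      n ^ 2 * (heatBound (2 * Fintype.card ι) (gapConst (Fintype.card ι)) *
        Real.exp (-(gapConst (Fintype.card ι) / 4) * (F - 1))) := by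
  have hn3 : 3 ≤ n := by
    have : 16 * Fintype.card ι + 40 ≤ (16 * Fintype.card ι + 40) ^ 2 :=
      Nat.le_self_pow (by norm_num) _
    omega
  have hA : (walk n ι - averaging (Placement n ι))ᵀ = walk n ι - averaging (Placement n ι) := by
    rw [Matrix.transpose_sub, walk_transpose, averaging_transpose]
  obtain ⟨α, v, h⟩ := exists_isEigenbasis
    (A := walk n ι - averaging (Placement n ι)) (by
      rw [Matrix.IsHermitian, Matrix.conjTranspose_eq_transpose_of_trivial]
      exact hA)
  have h1 := h.sum_abs_pow_le hn hF
  have h2 := h.abs_trace_pow_mul_le agreement_nonneg agreement_symm (D := n ^ 2)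
    (fun x => by rw [sum_agreement]; simp) (n ^ 4 * F) hA
  have hN : n ^ 4 * F ≠ 0 := by positivity
  obtain ⟨N, hN⟩ := Nat.exists_eq_succ_of_ne_zero hN
  rw [← trace_averaging_mul_agreement, ← Matrix.trace_sub, ← sub_mul]
  have h3 : walk n ι ^ (n ^ 4 * F) - averaging (Placement n ι) =
      (walk n ι - averaging (Placement n ι)) ^ (n ^ 4 * F) := by
    rw [hN, Nat.succ_eq_add_one, walk_pow_eq hn3, add_sub_cancel_left]
  rw [h3]
  exact h2.trans (mul_le_mul_of_nonneg_left h1 (by positivity))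

/-- Translation of a placement. -/
def Placement.shift (t : Board n) : Equiv.Perm (Placement n ι) where
  toFun x := ⟨fun l => x.1 l + t,
    mem_placements.2 fun _ _ h => mem_placements.1 x.2 (add_right_cancel h)⟩
  invFun x := ⟨fun l => x.1 l - t,
    mem_placements.2 fun _ _ h => mem_placements.1 x.2 (sub_left_injective h)⟩
  left_inv x := by simp
  right_inv x := by simp

theorem Placement.shift_slide (t d : Board n) (x : Placement n ι) :
    Placement.shift t (Placement.slide d x) = Placement.slide d (Placement.shift t x) := by
  refine Subtype.ext (funext fun l => ?_)
  simp only [Placement.shift, Placement.slide, _root_.slide, Equiv.coe_fn_mk,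
    Equiv.swap_apply_def, add_left_inj, add_right_comm _ t d]
  split_ifs <;> simp [add_right_comm]

theorem walk_pow_mul_agreement_shift (t : Board n) (N : ℕ) (x : Placement n ι) :
    (walk n ι ^ N * agreement n ι) (Placement.shift t x) (Placement.shift t x) =
      (walk n ι ^ N * agreement n ι) x x := by
  have h1 : Matrix.reindexAlgEquiv ℝ ℝ (Placement.shift t).symm (walk n ι) = walk n ι := by
    ext x y
    simp [walk, ← Placement.shift_slide]
  have h2 : Matrix.reindexAlgEquiv ℝ ℝ (Placement.shift t).symm (agreement n ι) =
      agreement n ι := by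
    ext x y
    simp [agreement, Placement.shift]
  have h3 : Matrix.reindexAlgEquiv ℝ ℝ (Placement.shift t).symm (walk n ι ^ N * agreement n ι) =
      walk n ι ^ N * agreement n ι := by rw [map_mul, map_pow, h1, h2]
  exact congrFun (congrFun h3 x) x

theorem trace_walk_pow_mul_agreement (b : Board n) (N : ℕ) :
    (walk n ι ^ N * agreement n ι).trace = n ^ 2 * ∑ x ∈ univ.filter
      (fun x : Placement n ι => x.1 none = b), (walk n ι ^ N * agreement n ι) x x := by
  rw [Matrix.trace, ← Finset.sum_fiberwise_of_maps_to (t := (univ : Finset (Board n)))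
    (g := fun x : Placement n ι => x.1 none) fun _ _ => Finset.mem_univ _]
  rw [Finset.sum_congr rfl (g := fun _ => ∑ x ∈ univ.filter
      (fun x : Placement n ι => x.1 none = b), (walk n ι ^ N * agreement n ι) x x),
    Finset.sum_const, Finset.card_univ, Fintype.card_prod, ZMod.card, nsmul_eq_mul]
  · push_cast; ring
  intro h _
  refine Finset.sum_nbij' (Placement.shift (b - h)) (Placement.shift (h - b)) ?_ ?_ ?_ ?_ ?_
  · intro x hx
    have := (Finset.mem_filter.1 hx).2
    exact Finset.mem_filter.2 ⟨Finset.mem_univ _, by simp [Placement.shift, this]⟩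
  · intro x hx
    have := (Finset.mem_filter.1 hx).2
    exact Finset.mem_filter.2 ⟨Finset.mem_univ _, by simp [Placement.shift, this]⟩
  · intro x _; exact Subtype.ext (funext fun l => by
      simp only [Placement.shift, Equiv.coe_fn_mk]; abel)
  · intro x _; exact Subtype.ext (funext fun l => by
      simp only [Placement.shift, Equiv.coe_fn_mk]; abel)
  · intro x _
    rw [walk_pow_mul_agreement_shift, Matrix.diag_apply]

end Moments

section PuzzleMoments

open Matrix

variable {n : ℕ} [NeZero n]

/-- The expectation of `G` after `N` steps of the puzzle chain. -/
noncomputable def puzzleExp (n : ℕ) [NeZero n] (N : ℕ) (G : Equiv.Perm (Board n) → ℝ) : ℝ :=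
  ∑ σ : Equiv.Perm (Board n), puzzleDist n N σ * G σ

theorem puzzleDist_nonneg (N : ℕ) (σ : Equiv.Perm (Board n)) : 0 ≤ puzzleDist n N σ := by
  induction N generalizing σ with
  | zero => simp only [puzzleDist]; split_ifs <;> norm_num
  | succ N ih =>
    rw [puzzleDist]
    exact Finset.sum_nonneg fun τ _ => mul_nonneg (ih τ) (by unfold puzzleStep; positivity)

theorem puzzleExp_sum {X : Type*} (N : ℕ) (s : Finset X) (G : X → Equiv.Perm (Board n) → ℝ) :
    puzzleExp n N (fun σ => ∑ i ∈ s, G i σ) = ∑ i ∈ s, puzzleExp n N (G i) := by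
  simp only [puzzleExp, Finset.mul_sum]
  exact Finset.sum_comm

theorem puzzleExp_const_mul (N : ℕ) (a : ℝ) (G : Equiv.Perm (Board n) → ℝ) :
    puzzleExp n N (fun σ => a * G σ) = a * puzzleExp n N G := by
  simp only [puzzleExp, Finset.mul_sum]
  exact Finset.sum_congr rfl fun σ _ => by ring

theorem abs_puzzleExp_sub_le (N : ℕ) {G H K : Equiv.Perm (Board n) → ℝ}
    (h : ∀ σ, |G σ - H σ| ≤ K σ) : |puzzleExp n N G - puzzleExp n N H| ≤ puzzleExp n N K := by
  rw [puzzleExp, puzzleExp, ← Finset.sum_sub_distrib]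
  refine (Finset.abs_sum_le_sum_abs _ _).trans (Finset.sum_le_sum fun σ _ => ?_)
  rw [← mul_sub, abs_mul, abs_of_nonneg (puzzleDist_nonneg N σ)]
  exact mul_le_mul_of_nonneg_left (h σ) (puzzleDist_nonneg N σ)

theorem puzzleExp_succ (N : ℕ) (G : Equiv.Perm (Board n) → ℝ) :
    puzzleExp n (N + 1) G = puzzleExp n N fun σ => 1 / 5 * ∑ d ∈ displacements n,
      G (Equiv.swap (σ (emptyLabel n)) (σ (emptyLabel n) + d) * σ) := by
  simp only [puzzleExp, puzzleDist, Finset.sum_mul]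
  rw [Finset.sum_comm]
  refine Finset.sum_congr rfl fun σ _ => ?_
  simp only [puzzleStep, Finset.card_filter, Nat.cast_sum, Nat.cast_ite, Nat.cast_one,
    Nat.cast_zero, mul_assoc, ← Finset.mul_sum, Finset.sum_mul]
  congr 2
  rw [Finset.sum_comm]
  simp

variable {ι : Type} [Fintype ι] [DecidableEq ι]

/-- The image of a placement under a permutation of the board. -/
def Placement.permute (σ : Equiv.Perm (Board n)) (x : Placement n ι) : Placement n ι :=
  ⟨σ ∘ x.1, mem_placements.2 (σ.injective.comp (mem_placements.1 x.2))⟩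

theorem puzzleExp_permute (N : ℕ) (g : Placement n ι → ℝ) {x : Placement n ι}
    (hx : x.1 none = emptyLabel n) :
    puzzleExp n N (fun σ => g (Placement.permute σ x)) = (walk n ι ^ N *ᵥ g) x := by
  induction N generalizing g with
  | zero =>
    simp only [puzzleExp, puzzleDist, ite_mul, one_mul, zero_mul, Finset.sum_ite_eq',
      Finset.mem_univ, if_true, pow_zero, Matrix.one_mulVec]
    rfl
  | succ N ih =>
    rw [puzzleExp_succ, pow_succ, ← Matrix.mulVec_mulVec, ← ih]
    congr 1
    funext σ
    rw [walk_mulVec]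
    congr 1
    refine Finset.sum_congr rfl fun d _ => congrArg g (Subtype.ext (funext fun l => ?_))
    simp [Placement.permute, Placement.slide, slide, hx]

open Classical in
theorem descFactorial_fixedPieces (σ : Equiv.Perm (Board n)) :
    ((fixedPieces n σ).descFactorial (Fintype.card ι) : ℝ) =
      ∑ x ∈ univ.filter (fun x : Placement n ι => x.1 none = emptyLabel n),
        agreement n ι (Placement.permute σ x) x := by
  have h1 : fixedPieces n σ = Fintype.card {p : Board n // p ≠ emptyLabel n ∧ σ p = p} :=
    (Fintype.card_subtype _).symm
  rw [h1, ← Fintype.card_embedding_eq]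
  simp only [agreement, Matrix.of_apply, Finset.sum_boole, Finset.filter_filter]
  rw [← Finset.card_univ]
  congr 1
  symm
  refine Finset.card_bij (fun x hx => ⟨fun i => ⟨x.1 (some i), fun h => ?_,
    (Finset.mem_filter.1 hx).2.2 i⟩, fun i j h => ?_⟩) ?_ ?_ ?_
  · rw [← (Finset.mem_filter.1 hx).2.1] at h
    exact absurd (mem_placements.1 x.2 h) (by simp)
  · exact Option.some_injective _ (mem_placements.1 x.2 (congrArg Subtype.val h))
  · intro x _
    exact Finset.mem_univ _
  · intro x hx y hy h
    refine Subtype.ext (funext fun l => ?_)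
    cases l with
    | none => rw [(Finset.mem_filter.1 hx).2.1, (Finset.mem_filter.1 hy).2.1]
    | some i => exact congrArg Subtype.val (DFunLike.congr_fun h i)
  · intro e _
    refine ⟨⟨fun l => l.elim (emptyLabel n) fun i => (e i).1, mem_placements.2 ?_⟩, ?_, ?_⟩
    · rintro (_ | i) (_ | j) h
      · rfl
      · exact absurd h.symm (e j).2.1
      · exact absurd h (e i).2.1
      · rw [e.injective (Subtype.ext h)]
    · exact Finset.mem_filter.2 ⟨Finset.mem_univ _, rfl, fun i => (e i).2.2⟩
    · rfl

theorem puzzleExp_descFactorial (N : ℕ) :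
    (n : ℝ) ^ 2 * puzzleExp n N (fun σ => (fixedPieces n σ).descFactorial (Fintype.card ι)) =
      (walk n ι ^ N * agreement n ι).trace := by
  simp only [descFactorial_fixedPieces (ι := ι)]
  rw [trace_walk_pow_mul_agreement (emptyLabel n), puzzleExp_sum]
  congr 1
  refine Finset.sum_congr rfl fun x hx => ?_
  rw [puzzleExp_permute N (fun y => agreement n ι y x) (Finset.mem_filter.1 hx).2]
  rfl

theorem abs_moment_sub_le {k : ℕ} (hn : (16 * k + 40) ^ 2 ≤ n) {F : ℕ} (hF : 1 ≤ F) :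
    |puzzleExp n (n ^ 4 * F) (fun σ => (fixedPieces n σ).descFactorial k) -
        (1 - k / (n : ℝ) ^ 2)| ≤
      heatBound (2 * k) (gapConst k) * Real.exp (-(gapConst k / 4) * (F - 1)) := by
  have hnn : n ≤ n * n := Nat.le_mul_self n
  have hkn : k + 1 ≤ n * n := by nlinarith
  have hne : Nonempty (Placement n (Fin k)) := by
    obtain ⟨e⟩ := Function.Embedding.nonempty_of_card_le (α := Option (Fin k)) (β := Board n)
      (by simpa [ZMod.card] using hkn)
    exact ⟨⟨e, mem_placements.2 e.injective⟩⟩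
  have hn0 : (0 : ℝ) < n ^ 2 := by
    have : 0 < n := Nat.pos_of_ne_zero (NeZero.ne n)
    positivity
  have h1 := abs_trace_sub_le (ι := Fin k) (n := n) (by simpa using hn) hF
  rw [← puzzleExp_descFactorial, Fintype.card_fin] at h1
  refine le_of_mul_le_mul_left (le_trans (le_of_eq ?_) h1) hn0
  rw [← abs_of_pos hn0, ← abs_mul, abs_of_pos hn0, mul_sub, mul_sub, mul_one,
    mul_div_cancel₀ _ hn0.ne']

end PuzzleMoments

section PoissonLimit

open Filter Topology

theorem abs_indicator_sub_le (X k I : ℕ) :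
    |(if X = k then (1 : ℝ) else 0) - ∑ i ∈ Finset.range (I + 1),
      (-1 : ℝ) ^ i * (((k + i).choose k : ℝ) * (X.choose (k + i) : ℝ))| ≤
      ((k + (I + 1)).choose k : ℝ) * (X.choose (k + (I + 1)) : ℝ) := by
  rcases lt_or_ge X k with h | h
  · have h0 : ∀ i, X.choose (k + i) = 0 := fun i => Nat.choose_eq_zero_of_lt (by omega)
    simp [h0, h.ne]
  obtain ⟨m, rfl⟩ := Nat.exists_eq_add_of_le h
  have hc : ∀ i, (((k + i).choose k : ℕ) : ℝ) * (k + m).choose (k + i) =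
      (k + m).choose k * m.choose i := fun i => by
    rcases le_or_gt i m with hi | hi
    · have := Nat.choose_mul (n := k + m) (k := k + i) (s := k) (by omega)
      rw [Nat.add_sub_cancel_left, Nat.add_sub_cancel_left, mul_comm] at this
      exact_mod_cast this
    · rw [Nat.choose_eq_zero_of_lt (by omega : k + m < k + i), Nat.choose_eq_zero_of_lt hi]
      simp
  simp only [hc]
  cases m with
  | zero =>
    rw [Finset.sum_range_succ', Finset.sum_eq_zero fun i _ => by simp]
    simp
  | succ m =>
    have h1 : ∑ i ∈ Finset.range (I + 1), (-1 : ℝ) ^ i * ((k + (m + 1)).choose k *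
        (m + 1).choose i) = (k + (m + 1)).choose k * ((-1) ^ I * m.choose I) := by
      have := Int.alternating_sum_range_choose_eq_choose (n := m) (m := I)
      have h2 : ∑ i ∈ Finset.range (I + 1), (-1 : ℝ) ^ i * (m + 1).choose i =
        (-1) ^ I * m.choose I := by exact_mod_cast this
      rw [← h2, Finset.mul_sum]
      exact Finset.sum_congr rfl fun i _ => by ring
    rw [h1, if_neg (by omega), zero_sub, abs_neg, abs_mul, abs_mul, abs_pow, abs_neg, abs_one,
      one_pow, one_mul, Nat.abs_cast, Nat.abs_cast]
    refine mul_le_mul_of_nonneg_left ?_ (Nat.cast_nonneg _)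
    rw [Nat.choose_succ_succ]
    push_cast
    linarith [(Nat.cast_nonneg (m.choose (I + 1)) : (0 : ℝ) ≤ _)]

theorem choose_div_factorial (k i : ℕ) :
    ((k + i).choose k : ℝ) / (k + i).factorial = 1 / (k.factorial * i.factorial) := by
  have h : ((k + i).choose k : ℝ) * k.factorial * i.factorial = (k + i).factorial := by
    have := Nat.choose_mul_factorial_mul_factorial (Nat.le_add_right k i)
    rw [Nat.add_sub_cancel_left] at this
    exact_mod_cast this
  have h1 : (k.factorial : ℝ) ≠ 0 := Nat.cast_ne_zero.2 (Nat.factorial_ne_zero _)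
  have h2 : (i.factorial : ℝ) ≠ 0 := Nat.cast_ne_zero.2 (Nat.factorial_ne_zero _)
  have h3 : ((k + i).factorial : ℝ) ≠ 0 := Nat.cast_ne_zero.2 (Nat.factorial_ne_zero _)
  rw [div_eq_div_iff h3 (mul_ne_zero h1 h2)]
  linarith

theorem choose_mul_choose_eq (X k i : ℕ) : ((k + i).choose k : ℝ) * X.choose (k + i) =
    1 / (k.factorial * i.factorial) * X.descFactorial (k + i) := by
  have h3 : ((k + i).factorial : ℝ) ≠ 0 := Nat.cast_ne_zero.2 (Nat.factorial_ne_zero _)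
  rw [← choose_div_factorial, Nat.descFactorial_eq_factorial_mul_choose]
  push_cast
  field_simp

theorem exists_abs_moment_sub_one_lt {f : ℕ → ℕ} (hf : Tendsto f atTop atTop) (k : ℕ) {δ : ℝ}
    (hδ : 0 < δ) : ∃ n₀ : ℕ, ∀ (n : ℕ) [NeZero n], n₀ ≤ n →
      |puzzleExp n (n ^ 4 * f n) (fun σ => (fixedPieces n σ).descFactorial k) - 1| < δ := by
  have hlim : Tendsto (fun n : ℕ => heatBound (2 * k) (gapConst k) *
      Real.exp (-(gapConst k / 4) * ((f n : ℝ) - 1)) + k / (n : ℝ) ^ 2) atTop (𝓝 0) := by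
    have h1 : Tendsto (fun n : ℕ => (gapConst k / 4) * ((f n : ℝ) - 1)) atTop atTop :=
      (tendsto_atTop_add_const_right _ (-1)
        (tendsto_natCast_atTop_atTop.comp hf)).const_mul_atTop
        (by have := gapConst_pos k; positivity)
    have h2 := (Real.tendsto_exp_neg_atTop_nhds_zero.comp h1).const_mul
      (heatBound (2 * k) (gapConst k))
    have h3 : Tendsto (fun n : ℕ => (k : ℝ) / (n : ℝ) ^ 2) atTop (𝓝 0) :=
      tendsto_const_nhds.div_atTop
        ((tendsto_pow_atTop (by norm_num)).comp tendsto_natCast_atTop_atTop)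
    have h4 := h2.add h3
    rw [mul_zero, add_zero] at h4
    refine h4.congr fun n => ?_
    simp only [Function.comp_apply, neg_mul]
  have hev := (hlim.eventually (gt_mem_nhds hδ)).and ((eventually_ge_atTop ((16 * k + 40) ^ 2)).and
    (hf.eventually (eventually_ge_atTop 1)))
  obtain ⟨n₀, h⟩ := eventually_atTop.1 hev
  refine ⟨n₀, fun n _ hn => ?_⟩
  obtain ⟨h1, h2, h3⟩ := h n hn
  have h4 := abs_moment_sub_le h2 h3
  have h5 : (0 : ℝ) ≤ k / (n : ℝ) ^ 2 := by positivity
  rw [abs_le] at h4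
  rw [abs_lt]
  constructor <;> linarith [h4.1, h4.2]

theorem abs_probability_sub_le {n : ℕ} [NeZero n] {N k I : ℕ} {δ : ℝ}
    (hδ : ∀ j ≤ k + (I + 1),
      |puzzleExp n N (fun σ => (fixedPieces n σ).descFactorial j) - 1| ≤ δ) :
    |puzzleExp n N (fun σ => if fixedPieces n σ = k then 1 else 0) -
      (∑ i ∈ Finset.range (I + 1), (-1) ^ i / (i.factorial : ℝ)) / k.factorial| ≤
      (1 + δ) / (I + 1).factorial + (I + 1) * δ := by
  have hfac : ∀ i : ℕ, (1 : ℝ) ≤ i.factorial := fun i => by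
    exact_mod_cast Nat.factorial_pos i
  have hδ0 : 0 ≤ δ := (abs_nonneg _).trans (hδ 0 (by omega))
  set E : ℕ → ℝ := fun j => puzzleExp n N fun σ => (fixedPieces n σ).descFactorial j with hE
  have h1 := abs_puzzleExp_sub_le (n := n) N fun σ => abs_indicator_sub_le (fixedPieces n σ) k I
  simp only [choose_mul_choose_eq] at h1
  rw [puzzleExp_sum] at h1
  simp only [puzzleExp_const_mul] at h1
  have h2 : 1 / ((k.factorial : ℝ) * (I + 1).factorial) * E (k + (I + 1)) ≤
      (1 + δ) / (I + 1).factorial := by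
    have h3 : E (k + (I + 1)) ≤ 1 + δ := by
      have := (abs_le.1 (hδ (k + (I + 1)) le_rfl)).2
      linarith
    calc _ ≤ 1 / ((k.factorial : ℝ) * (I + 1).factorial) * (1 + δ) := by gcongr
      _ ≤ 1 / (1 * (I + 1).factorial) * (1 + δ) := by
        gcongr
        exact hfac k
      _ = _ := by ring
  have h4 : |∑ i ∈ Finset.range (I + 1), (-1) ^ i * (1 / ((k.factorial : ℝ) * i.factorial) *
      E (k + i)) - (∑ i ∈ Finset.range (I + 1), (-1) ^ i / (i.factorial : ℝ)) / k.factorial| ≤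
      (I + 1) * δ := by
    rw [Finset.sum_div, ← Finset.sum_sub_distrib]
    refine (Finset.abs_sum_le_sum_abs _ _).trans ?_
    refine (Finset.sum_le_card_nsmul _ _ δ fun i hi => ?_).trans ?_
    · have e : (-1) ^ i * (1 / ((k.factorial : ℝ) * i.factorial) * E (k + i)) -
          (-1) ^ i / (i.factorial : ℝ) / k.factorial =
          (-1) ^ i * (1 / (k.factorial * i.factorial) * (E (k + i) - 1)) := by
        field_simp
      rw [e, abs_mul, abs_pow, abs_neg, abs_one, one_pow, one_mul, abs_mul]
      have h5 : |1 / ((k.factorial : ℝ) * i.factorial)| ≤ 1 := by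
        rw [abs_of_nonneg (by positivity), div_le_one (by positivity)]
        nlinarith [hfac k, hfac i]
      have h6 := hδ (k + i) (by have := Finset.mem_range.1 hi; omega)
      calc _ ≤ 1 * δ := mul_le_mul h5 h6 (abs_nonneg _) zero_le_one
        _ = δ := one_mul δ
    · rw [Finset.card_range, nsmul_eq_mul]
      push_cast
      exact le_rfl
  refine (abs_sub_le _ _ _).trans (add_le_add (h1.trans h2) h4)

theorem tendsto_alternating_sum_div_factorial :
    Tendsto (fun I : ℕ => ∑ i ∈ Finset.range (I + 1), (-1 : ℝ) ^ i / i.factorial) atTop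
      (𝓝 (Real.exp (-1))) := by
  have h := (NormedSpace.expSeries_div_hasSum_exp (-1 : ℝ)).tendsto_sum_nat
  rw [← Real.exp_eq_exp_ℝ] at h
  exact h.comp (tendsto_add_atTop_nat 1)

end PoissonLimit

open Classical in
/-- **Poisson limit for fixed points of the `n²−1` puzzle.**  If `f(n) → ∞` and the
`n²−1` puzzle chain is run for `n⁴·f(n)` steps from the identity, then for each fixed `k`
the probability that exactly `k` numbered pieces occupy their original position converges
to `e⁻¹/k!` as `n → ∞`. -/
theorem puzzle_fixed_points_poisson (f : ℕ → ℕ)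
    (hf : Filter.Tendsto f Filter.atTop Filter.atTop) (k : ℕ) :
    ∀ ε : ℝ, 0 < ε → ∃ n₀ : ℕ, ∀ (n : ℕ) [NeZero n], 3 ≤ n → n₀ ≤ n →
      |(∑ σ : Equiv.Perm (ZMod n × ZMod n),
          if fixedPieces n σ = k then puzzleDist n (n ^ 4 * f n) σ else 0) -
        Real.exp (-1) / (Nat.factorial k : ℝ)| < ε := by
  intro ε hε
  have hs := (tendsto_alternating_sum_div_factorial.div_const (k.factorial : ℝ)).eventually
    (Metric.ball_mem_nhds _ (by positivity : 0 < ε / 3))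
  have hr : Filter.Tendsto (fun I : ℕ => 2 / ((I + 1).factorial : ℝ)) Filter.atTop (nhds 0) :=
    tendsto_const_nhds.div_atTop (tendsto_natCast_atTop_atTop.comp
      (Filter.tendsto_atTop_mono (fun I => Nat.self_le_factorial (I + 1))
        (Filter.tendsto_add_atTop_nat 1)))
  obtain ⟨I, hI, hI'⟩ := (hs.and (hr.eventually (gt_mem_nhds (by positivity : 0 < ε / 3)))).exists
  set δ := min 1 (ε / (3 * (I + 1))) with hδ
  have hδ0 : 0 < δ := lt_min one_pos (by positivity)
  choose n₀ hn₀ using fun j => exists_abs_moment_sub_one_lt hf j hδ0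
  refine ⟨(Finset.range (k + (I + 1) + 1)).sup n₀, fun n _ _ hn => ?_⟩
  have h1 := abs_probability_sub_le (n := n) (N := n ^ 4 * f n) (k := k) (I := I) (δ := δ)
    fun j hj => (hn₀ j n ((Finset.le_sup (Finset.mem_range.2 (by omega))).trans hn)).le
  have h2 : (1 + δ) / ((I + 1).factorial : ℝ) ≤ 2 / (I + 1).factorial := by
    gcongr
    linarith [min_le_left 1 (ε / (3 * ((I : ℝ) + 1)))]
  have h3 : ((I : ℝ) + 1) * δ ≤ ε / 3 := by
    calc ((I : ℝ) + 1) * δ ≤ (I + 1) * (ε / (3 * (I + 1))) :=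
          mul_le_mul_of_nonneg_left (min_le_right _ _) (by positivity)
      _ = ε / 3 := by field_simp
  have h4 : (∑ σ : Equiv.Perm (ZMod n × ZMod n),
      if fixedPieces n σ = k then puzzleDist n (n ^ 4 * f n) σ else 0) =
      puzzleExp n (n ^ 4 * f n) fun σ => if fixedPieces n σ = k then 1 else 0 := by
    simp only [puzzleExp, mul_ite, mul_one, mul_zero]
  rw [h4]
  rw [Real.dist_eq] at hI
  refine (abs_sub_le _ _ _).trans_lt (add_lt_add_of_le_of_lt h1 hI |>.trans_le ?_)
  linarith
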